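/- arXiv:1410.3114 — 2 statements merged into one kernel-verified Lean document; each statement's English description precedes it below -/
import Mathlib

section
/- Let D be a divisor on a metric graph Γ and let P ∈ Γ. Then there exists a unique P-reduced divisor D_P on Γ that is linearly equivalent to D. -/
noncomputable section

/-- The star with `n` rays of radius `r` in the complex plane:
`{ z ∈ ℂ : z = t·e^{2πik/n}, t ∈ [0,r], k ∈ ℤ }`. -/
def starSet (n : ℕ) (r : ℝ) : Set ℂ :=
  {z | ∃ t ∈ Set.Icc (0 : ℝ) r, ∃ k : ℤ,
    z = (t : ℂ) * Complex.exp (2 * (Real.pi : ℂ) * Complex.I * (k : ℂ) / (n : ℂ))}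

/-- `P` has a neighbourhood isometric to a star with `n` rays of some radius `r > 0`,
with `P` corresponding to `0`. -/
def HasStarNbhd (Γ : Type*) [MetricSpace Γ] (P : Γ) (n : ℕ) : Prop :=
  ∃ r > (0 : ℝ), ∃ U ∈ nhds P, ∃ φ : Γ → ℂ,
    φ P = 0 ∧ φ '' U = starSet n r ∧
    ∀ x ∈ U, ∀ y ∈ U, dist (φ x) (φ y) = dist x y

/-- A metric graph: a compact connected metric space in which every point has a
neighbourhood isometric to a star with `n ≥ 1` rays. -/
def IsMetricGraph (Γ : Type*) [MetricSpace Γ] : Prop :=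
  CompactSpace Γ ∧ ConnectedSpace Γ ∧ ∀ P : Γ, ∃ n : ℕ, 1 ≤ n ∧ HasStarNbhd Γ P n

/-- The valence of a point: the number of rays of a star neighbourhood. -/
noncomputable def valence (Γ : Type*) [MetricSpace Γ] (P : Γ) : ℕ :=
  sInf {n : ℕ | 1 ≤ n ∧ HasStarNbhd Γ P n}

/-- A vertex is a point of valence different from `2`. -/
def IsVertex (Γ : Type*) [MetricSpace Γ] (P : Γ) : Prop := valence Γ P ≠ 2

/-- The genus of a metric graph: `#edges - #vertices + 1`, the edges being the connected
components of the complement of the vertex set. -/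
noncomputable def graphGenus (Γ : Type*) [MetricSpace Γ] : ℤ :=
  (Nat.card (ConnectedComponents {P : Γ // ¬ IsVertex Γ P}) : ℤ)
    - (Nat.card {P : Γ // IsVertex Γ P} : ℤ) + 1

/-- A divisor on `Γ` : a finitely supported formal `ℤ`-linear combination of points. -/
abbrev Divisor (Γ : Type*) : Type _ := Γ →₀ ℤ

/-- The degree of a divisor. -/
def divDeg {Γ : Type*} (D : Divisor Γ) : ℤ := D.sum fun _ n => n

/-- A divisor is effective if all its coefficients are nonnegative. -/
def Effective {Γ : Type*} (D : Divisor Γ) : Prop := ∀ P : Γ, 0 ≤ D P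

/-- An arc based at `P` : an isometric parametrization of a segment emanating from `P`. -/
def IsArcAt {Γ : Type*} [MetricSpace Γ] (P : Γ) (τ : ℝ → Γ) : Prop :=
  τ 0 = P ∧ ∃ a > (0 : ℝ), ∀ s ∈ Set.Icc (0 : ℝ) a, ∀ t ∈ Set.Icc (0 : ℝ) a,
    dist (τ s) (τ t) = |s - t|

/-- Two arcs are equivalent (define the same tangent direction) when they agree near `0`. -/
def ArcEquiv {Γ : Type*} (τ τ' : ℝ → Γ) : Prop :=
  ∃ ε > (0 : ℝ), ∀ t ∈ Set.Icc (0 : ℝ) ε, τ t = τ' t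

/-- `f` has (one-sided) slope `s` along the arc `τ`. -/
def HasSlopeAlong {Γ : Type*} (f : Γ → ℝ) (τ : ℝ → Γ) (s : ℤ) : Prop :=
  ∃ ε > (0 : ℝ), ∀ t ∈ Set.Icc (0 : ℝ) ε, f (τ t) = f (τ 0) + (s : ℝ) * t

/-- A rational function on a metric graph: continuous and piecewise affine with
integer slopes, i.e. having an integer slope along every arc. -/
def IsRational (Γ : Type*) [MetricSpace Γ] (f : Γ → ℝ) : Prop :=
  Continuous f ∧ ∀ (P : Γ) (τ : ℝ → Γ), IsArcAt P τ → ∃ s : ℤ, HasSlopeAlong f τ s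

/-- `div f` has coefficient `m` at `P`: the sum of the slopes of `f` in all tangent
directions emanating from `P` equals `m`. -/
def HasOrderAt (Γ : Type*) [MetricSpace Γ] (f : Γ → ℝ) (P : Γ) (m : ℤ) : Prop :=
  ∃ (n : ℕ) (τ : Fin n → ℝ → Γ) (s : Fin n → ℤ),
    (∀ i, IsArcAt P (τ i)) ∧
    Pairwise (fun i j => ¬ ArcEquiv (τ i) (τ j)) ∧
    (∀ σ : ℝ → Γ, IsArcAt P σ → ∃ i, ArcEquiv σ (τ i)) ∧
    (∀ i, HasSlopeAlong f (τ i) (s i)) ∧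
    m = ∑ i, s i

/-- Linear equivalence of divisors: `D₂ - D₁ = div f` for some rational function `f`. -/
def LinEquiv (Γ : Type*) [MetricSpace Γ] (D₁ D₂ : Divisor Γ) : Prop :=
  ∃ f : Γ → ℝ, IsRational Γ f ∧ ∀ P : Γ, HasOrderAt Γ f P (D₂ P - D₁ P)

/-- `D` is linearly equivalent to an effective divisor. -/
def EquivEffective (Γ : Type*) [MetricSpace Γ] (D : Divisor Γ) : Prop :=
  ∃ D' : Divisor Γ, Effective D' ∧ LinEquiv Γ D D'

/-- For every effective divisor `E` of degree `r`, `D - E` is linearly equivalent to an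
effective divisor. -/
def RankGE (Γ : Type*) [MetricSpace Γ] (D : Divisor Γ) (r : ℕ) : Prop :=
  ∀ E : Divisor Γ, Effective E → divDeg E = (r : ℤ) → EquivEffective Γ (D - E)

/-- The rank of a divisor: `-1` if `D` is not equivalent to an effective divisor, and
otherwise the largest `r ≥ 0` such that `D - E` is equivalent to an effective divisor
for every effective `E` of degree `r`. -/
noncomputable def divRank (Γ : Type*) [MetricSpace Γ] (D : Divisor Γ) : ℤ :=
  sSup (insert (-1) {n : ℤ | ∃ r : ℕ, n = (r : ℤ) ∧ RankGE Γ D r})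

/-- The arc `τ` immediately leaves the set `X`. -/
def ArcLeaves {Γ : Type*} (X : Set Γ) (τ : ℝ → Γ) : Prop :=
  ∃ ε > (0 : ℝ), ∀ t ∈ Set.Ioc (0 : ℝ) ε, τ t ∉ X

/-- `P` is a non-saturated boundary point of `X` with respect to `D` : the number of
tangent directions at `P` leaving `X` is strictly greater than `D P`. -/
def NonSaturated (Γ : Type*) [MetricSpace Γ] (D : Divisor Γ) (X : Set Γ) (P : Γ) : Prop :=
  P ∈ frontier X ∧ ∃ (n : ℕ) (τ : Fin n → ℝ → Γ),
    (∀ i, IsArcAt P (τ i)) ∧ (∀ i, ArcLeaves X (τ i)) ∧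
    Pairwise (fun i j => ¬ ArcEquiv (τ i) (τ j)) ∧ D P < (n : ℤ)

/-- `D` is `P₀`-reduced. -/
def IsReducedDivisor (Γ : Type*) [MetricSpace Γ] (D : Divisor Γ) (P₀ : Γ) : Prop :=
  (∀ P : Γ, P ≠ P₀ → 0 ≤ D P) ∧
  ∀ X : Set Γ, IsClosed X → X.Nonempty → P₀ ∉ X → ∃ P, NonSaturated Γ D X P

/-- The restriction of a divisor on `Γ` to a divisor on a subset `S` (with the induced
metric); divisors supported on `S` are identified with divisors on `S` this way. -/
noncomputable def DivRestrict {Γ : Type*} (S : Set Γ) (D : Divisor Γ) : Divisor ↥S :=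
  Finsupp.comapDomain Subtype.val D Subtype.coe_injective.injOn

/-- Linear equivalence computed on the subgraph `S` of `Γ`. -/
def LinEquivOn {Γ : Type*} [MetricSpace Γ] (S : Set Γ) (D₁ D₂ : Divisor Γ) : Prop :=
  LinEquiv ↥S (DivRestrict S D₁) (DivRestrict S D₂)

/-- The rank computed on the subgraph `S` of `Γ`. -/
noncomputable def divRankOn {Γ : Type*} [MetricSpace Γ] (S : Set Γ) (D : Divisor Γ) : ℤ :=
  divRank ↥S (DivRestrict S D)

/-- A free divisor: effective, of rank at least one, and removing any point decreases
the rank. -/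
def IsFreeDivisor (Γ : Type*) [MetricSpace Γ] (D : Divisor Γ) : Prop :=
  Effective D ∧ 1 ≤ divRank Γ D ∧
  ∀ P : Γ, divRank Γ (D - Finsupp.single P 1) < divRank Γ D

/-- The canonical divisor `K_Γ = Σ_P (val(P) - 2)·P`. -/
def IsCanonical (Γ : Type*) [MetricSpace Γ] (K : Divisor Γ) : Prop :=
  ∀ P : Γ, K P = (valence Γ P : ℤ) - 2

/-- A very special divisor: effective with `rk(D) > 0` and `rk(K_Γ - D) > 0`. -/
def VerySpecial (Γ : Type*) [MetricSpace Γ] (D : Divisor Γ) : Prop :=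
  Effective D ∧ 0 < divRank Γ D ∧
  ∃ K : Divisor Γ, IsCanonical Γ K ∧ 0 < divRank Γ (K - D)

/-- `φ` is an `L`-periodic locally isometric parametrization of the circle `S ⊆ Γ`
of circumference `L`. -/
def CircleParam {Γ : Type*} [MetricSpace Γ] (S : Set Γ) (L : ℝ) (φ : ℝ → Γ) : Prop :=
  0 < L ∧ (∀ t : ℝ, φ (t + L) = φ t) ∧ Set.range φ = S ∧
  ∀ s t : ℝ, |s - t| ≤ L / 2 → dist (φ s) (φ t) = |s - t|

/-- `S` is a metric circle inside `Γ`. -/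
def IsCircleSet {Γ : Type*} [MetricSpace Γ] (S : Set Γ) : Prop :=
  ∃ (L : ℝ) (φ : ℝ → Γ), CircleParam S L φ

end

namespace MetricGraph

open Filter Topology Set

section Slopes

variable {Γ : Type*} {f g : Γ → ℝ} {σ τ υ : ℝ → Γ} {s s' : ℤ}

theorem hasSlopeAlong_iff :
    HasSlopeAlong f τ s ↔ ∀ᶠ t in 𝓝[≥] (0 : ℝ), f (τ t) = f (τ 0) + s * t :=
  mem_nhdsGE_iff_exists_Icc_subset.symm

theorem arcEquiv_iff : ArcEquiv τ σ ↔ ∀ᶠ t in 𝓝[≥] (0 : ℝ), τ t = σ t :=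
  mem_nhdsGE_iff_exists_Icc_subset.symm

theorem arcLeaves_iff {X : Set Γ} : ArcLeaves X τ ↔ ∀ᶠ t in 𝓝[>] (0 : ℝ), τ t ∉ X :=
  mem_nhdsGT_iff_exists_Ioc_subset.symm

theorem arcEquiv_symm (h : ArcEquiv τ σ) : ArcEquiv σ τ := by
  rw [arcEquiv_iff] at *
  exact h.mono fun t ht => ht.symm

theorem arcEquiv_trans (h : ArcEquiv τ σ) (h' : ArcEquiv σ υ) : ArcEquiv τ υ := by
  rw [arcEquiv_iff] at *
  filter_upwards [h, h'] with t h1 h2 using h1.trans h2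

theorem arcEquiv_zero (h : ArcEquiv τ σ) : τ 0 = σ 0 := by
  obtain ⟨ε, hε, h⟩ := h
  exact h 0 ⟨le_rfl, hε.le⟩

theorem slope_congr_arc (h : HasSlopeAlong f τ s) (e : ArcEquiv τ σ) : HasSlopeAlong f σ s := by
  have h0 := arcEquiv_zero e
  rw [hasSlopeAlong_iff] at *
  rw [arcEquiv_iff] at e
  filter_upwards [h, e] with t h1 h2
  rw [← h2, ← h0, h1]

theorem eventually_pos {p : ℝ → Prop} (h : ∀ᶠ t in 𝓝[≥] (0 : ℝ), p t) :
    ∀ᶠ t in 𝓝[>] (0 : ℝ), 0 < t ∧ p t :=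
  (eventually_mem_nhdsWithin).and (h.filter_mono (nhdsWithin_mono _ Ioi_subset_Ici_self))

theorem slope_unique (h : HasSlopeAlong f τ s) (h' : HasSlopeAlong f τ s') : s = s' := by
  rw [hasSlopeAlong_iff] at *
  obtain ⟨t, ht, h1, h2⟩ := (eventually_pos (h.and h')).exists
  have : (s : ℝ) * t = s' * t := by linarith
  exact_mod_cast mul_right_cancel₀ ht.ne' this

theorem slope_add (h : HasSlopeAlong f τ s) (h' : HasSlopeAlong g τ s') :
    HasSlopeAlong (f + g) τ (s + s') := by
  rw [hasSlopeAlong_iff] at *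
  filter_upwards [h, h'] with t h1 h2
  simp only [Pi.add_apply, h1, h2]
  push_cast
  ring

theorem slope_neg (h : HasSlopeAlong f τ s) : HasSlopeAlong (-f) τ (-s) := by
  rw [hasSlopeAlong_iff] at *
  filter_upwards [h] with t h1
  simp only [Pi.neg_apply, h1]
  push_cast
  ring

theorem slope_const (c : ℝ) : HasSlopeAlong (fun _ : Γ => c) τ 0 := by
  rw [hasSlopeAlong_iff]
  simp

theorem slope_nonpos (h : HasSlopeAlong f τ s) (hm : ∀ x, f x ≤ f (τ 0)) : s ≤ 0 := by
  rw [hasSlopeAlong_iff] at h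
  obtain ⟨t, ht, h1⟩ := (eventually_pos h).exists
  have h2 := hm (τ t)
  rw [h1] at h2
  have : (s : ℝ) ≤ 0 := by
    by_contra! h3
    have := mul_pos h3 ht
    linarith
  exact_mod_cast this

theorem slope_nonneg (h : HasSlopeAlong f τ s) (hm : ∀ x, f (τ 0) ≤ f x) : 0 ≤ s := by
  have := slope_nonpos (slope_neg h) fun x => by simpa using hm x
  omega

end Slopes

section Orders

variable {Γ : Type*} [MetricSpace Γ] {f g : Γ → ℝ} {P Q : Γ} {m m' : ℤ}

/-- A family of arcs representing every tangent direction at `P` exactly once. -/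
def IsArcFrame (P : Γ) {ι : Type*} (τ : ι → ℝ → Γ) : Prop :=
  (∀ i, IsArcAt P (τ i)) ∧ Pairwise (fun i j => ¬ ArcEquiv (τ i) (τ j)) ∧
    ∀ σ : ℝ → Γ, IsArcAt P σ → ∃ i, ArcEquiv σ (τ i)

theorem IsArcFrame.hasOrderAt {n : ℕ} {τ : Fin n → ℝ → Γ} (h : IsArcFrame P τ)
    {s : Fin n → ℤ} (hs : ∀ i, HasSlopeAlong f (τ i) (s i)) : HasOrderAt Γ f P (∑ i, s i) :=
  ⟨n, τ, s, h.1, h.2.1, h.2.2, hs, rfl⟩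

theorem IsArcFrame.exists_slopes {ι : Type*} [Fintype ι] {τ : ι → ℝ → Γ} (h : IsArcFrame P τ)
    (hm : HasOrderAt Γ f P m) :
    ∃ s : ι → ℤ, (∀ i, HasSlopeAlong f (τ i) (s i)) ∧ m = ∑ i, s i := by
  obtain ⟨n, υ, s, h1, h2, h3, h4, rfl⟩ := hm
  choose e he using fun i => h3 (τ i) (h.1 i)
  refine ⟨fun i => s (e i), fun i => slope_congr_arc (h4 _) (arcEquiv_symm (he i)), ?_⟩
  have inj : Function.Injective e := by
    intro i j hij
    by_contra hne
    have hj := he j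
    rw [← hij] at hj
    exact h.2.1 hne (arcEquiv_trans (he i) (arcEquiv_symm hj))
  have surj : Function.Surjective e := by
    intro k
    obtain ⟨i, hi⟩ := h.2.2 (υ k) (h1 k)
    refine ⟨i, ?_⟩
    by_contra hne
    exact h2 (Ne.symm hne) (arcEquiv_trans hi (he i))
  exact (Function.Bijective.sum_comp ⟨inj, surj⟩ s).symm

theorem HasOrderAt.frame (h : HasOrderAt Γ f P m) :
    ∃ (n : ℕ) (τ : Fin n → ℝ → Γ), IsArcFrame P τ := by
  obtain ⟨n, υ, s, h1, h2, h3, h4, rfl⟩ := h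
  exact ⟨n, υ, h1, h2, h3⟩

theorem HasOrderAt.unique (h : HasOrderAt Γ f P m) (h' : HasOrderAt Γ f P m') : m = m' := by
  obtain ⟨n, τ, ht⟩ := HasOrderAt.frame h
  obtain ⟨s, hs, rfl⟩ := ht.exists_slopes h
  obtain ⟨s', hs', rfl⟩ := ht.exists_slopes h'
  exact Finset.sum_congr rfl fun i _ => slope_unique (hs i) (hs' i)

theorem HasOrderAt.add (h : HasOrderAt Γ f P m) (h' : HasOrderAt Γ g P m') :
    HasOrderAt Γ (f + g) P (m + m') := by
  obtain ⟨n, τ, ht⟩ := HasOrderAt.frame h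
  obtain ⟨s, hs, rfl⟩ := ht.exists_slopes h
  obtain ⟨s', hs', rfl⟩ := ht.exists_slopes h'
  rw [← Finset.sum_add_distrib]
  exact ht.hasOrderAt fun i => slope_add (hs i) (hs' i)

theorem HasOrderAt.neg (h : HasOrderAt Γ f P m) : HasOrderAt Γ (-f) P (-m) := by
  obtain ⟨n, τ, ht⟩ := HasOrderAt.frame h
  obtain ⟨s, hs, rfl⟩ := ht.exists_slopes h
  rw [← Finset.sum_neg_distrib]
  exact ht.hasOrderAt fun i => slope_neg (hs i)

/-- `div f = E`. -/
def HasDiv (f : Γ → ℝ) (E : Divisor Γ) : Prop :=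
  IsRational Γ f ∧ ∀ P, HasOrderAt Γ f P (E P)

variable {E E' : Divisor Γ}

theorem linEquiv_iff {D D' : Divisor Γ} : LinEquiv Γ D D' ↔ ∃ f, HasDiv f (D' - D) := Iff.rfl

theorem HasDiv.add (h : HasDiv f E) (h' : HasDiv g E') : HasDiv (f + g) (E + E') := by
  refine ⟨⟨h.1.1.add h'.1.1, fun P τ hτ => ?_⟩, fun P => HasOrderAt.add (h.2 P) (h'.2 P)⟩
  obtain ⟨s, hs⟩ := h.1.2 P τ hτ
  obtain ⟨s', hs'⟩ := h'.1.2 P τ hτ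
  exact ⟨_, slope_add hs hs'⟩

theorem HasDiv.neg (h : HasDiv f E) : HasDiv (-f) (-E) := by
  refine ⟨⟨h.1.1.neg, fun P τ hτ => ?_⟩, fun P => HasOrderAt.neg (h.2 P)⟩
  obtain ⟨s, hs⟩ := h.1.2 P τ hτ
  exact ⟨_, slope_neg hs⟩

/-- At a maximum, the order is at most minus the number of directions of strict descent. -/
theorem HasOrderAt.le_of_isMax (h : HasOrderAt Γ f P m) (hm : ∀ x, f x ≤ f P) {n : ℕ}
    {τ : Fin n → ℝ → Γ} (hτ : ∀ i, IsArcAt P (τ i))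
    (hl : ∀ i, ArcLeaves {x | f x = f P} (τ i))
    (hne : Pairwise fun i j => ¬ ArcEquiv (τ i) (τ j)) : m ≤ -n := by
  obtain ⟨k, υ, s, h1, h2, h3, h4, rfl⟩ := h
  have hnonpos : ∀ i, s i ≤ 0 := fun i =>
    slope_nonpos (h4 i) fun x => by rw [(h1 i).1]; exact hm x
  choose e he using fun i => h3 (τ i) (hτ i)
  have inj : Function.Injective e := by
    intro i j hij
    by_contra hne'
    have hj := he j
    rw [← hij] at hj
    exact hne hne' (arcEquiv_trans (he i) (arcEquiv_symm hj))
  have hneg : ∀ i, s (e i) ≤ -1 := by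
    intro i
    have hs := slope_congr_arc (h4 (e i)) (arcEquiv_symm (he i))
    rcases (hnonpos (e i)).lt_or_eq with h | h
    · omega
    · exfalso
      rw [h, hasSlopeAlong_iff] at hs
      obtain ⟨t, ht, ht'⟩ := ((eventually_pos hs).and (arcLeaves_iff.1 (hl i))).exists
      refine ht' ?_
      simpa [(hτ i).1] using ht.2
  calc ∑ i, s i ≤ ∑ i ∈ Finset.univ.map ⟨e, inj⟩, s i := by
        rw [← Finset.sum_sdiff (Finset.subset_univ (Finset.univ.map ⟨e, inj⟩))]
        have := Finset.sum_nonpos (s := Finset.univ \ Finset.univ.map ⟨e, inj⟩)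
          fun i _ => hnonpos i
        linarith
    _ = ∑ i, s (e i) := by simp
    _ ≤ ∑ i : Fin n, (-1 : ℤ) := Finset.sum_le_sum fun i _ => hneg i
    _ = -n := by simp

/-- A rational function joining a reduced divisor to a divisor effective away from the base point
attains its maximum at the base point. -/
theorem IsReducedDivisor.le_basePoint [CompactSpace Γ] {D D' : Divisor Γ}
    (hD : IsReducedDivisor Γ D P) (hD' : ∀ x, x ≠ P → 0 ≤ D' x) (hf : HasDiv f (D' - D)) (x : Γ) :
    f x ≤ f P := by
  obtain ⟨z, -, hz⟩ := isCompact_univ.exists_isMaxOn ⟨x, mem_univ x⟩ hf.1.1.continuousOn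
  replace hz : ∀ y, f y ≤ f z := fun y => hz (mem_univ y)
  suffices h : f P = f z by rw [h]; exact hz x
  by_contra hP
  obtain ⟨Q, hQ, n, τ, h1, h2, h3, h4⟩ := hD.2 {y | f y = f z}
    (isClosed_eq hf.1.1 continuous_const) ⟨z, rfl⟩ hP
  have hQz : f Q = f z := (isClosed_eq hf.1.1 continuous_const).frontier_subset hQ
  have hle := HasOrderAt.le_of_isMax (hf.2 Q) (by rw [hQz]; exact hz) h1 (by rwa [hQz]) h3
  have hQP : Q ≠ P := by rintro rfl; exact hP hQz
  have := hD' Q hQP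
  simp only [Finsupp.coe_sub, Pi.sub_apply] at hle
  omega

theorem IsReducedDivisor.unique [CompactSpace Γ] {D D₁ D₂ : Divisor Γ}
    (h₁ : IsReducedDivisor Γ D₁ P) (h₂ : IsReducedDivisor Γ D₂ P)
    (e₁ : LinEquiv Γ D D₁) (e₂ : LinEquiv Γ D D₂) : D₁ = D₂ := by
  obtain ⟨f₁, hf₁⟩ := linEquiv_iff.1 e₁
  obtain ⟨f₂, hf₂⟩ := linEquiv_iff.1 e₂
  have h : HasDiv (f₂ + -f₁) (D₂ - D₁) := by
    have := hf₂.add hf₁.neg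
    rwa [show D₂ - D + -(D₁ - D) = D₂ - D₁ by abel] at this
  have h' : HasDiv (f₁ + -f₂) (D₁ - D₂) := by
    have := hf₁.add hf₂.neg
    rwa [show D₁ - D + -(D₂ - D) = D₁ - D₂ by abel] at this
  have hc : f₂ + -f₁ = fun _ => (f₂ + -f₁) P := by
    funext x
    have a := IsReducedDivisor.le_basePoint h₁ h₂.1 h x
    have b := IsReducedDivisor.le_basePoint h₂ h₁.1 h' x
    simp only [Pi.add_apply, Pi.neg_apply] at a b ⊢
    linarith
  ext Q
  obtain ⟨n, τ, hτ⟩ := HasOrderAt.frame (h.2 Q)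
  have h0 := hτ.hasOrderAt (f := f₂ + -f₁) (s := fun _ => 0) fun i => by
    rw [hc]
    exact slope_const _
  have := HasOrderAt.unique (h.2 Q) h0
  simp only [Finsupp.coe_sub, Pi.sub_apply, Finset.sum_const_zero] at this
  omega

end Orders

section Stars

/-- The closed ball of radius `r` about `Q` contains the `n` rays `τ i '' [0, r]`, which are
geodesic, meet only in `Q` and exhaust the open ball. -/
structure IsStar {Γ : Type*} [MetricSpace Γ] (Q : Γ) (n : ℕ) (r : ℝ) (τ : Fin n → ℝ → Γ) :
    Prop where
  pos : 0 < r
  zero : ∀ i, τ i 0 = Q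
  iso : ∀ i, ∀ s ∈ Icc 0 r, ∀ t ∈ Icc 0 r, dist (τ i s) (τ i t) = |s - t|
  cover : ∀ x, dist x Q < r → ∃ i, x = τ i (dist x Q)
  rigid : ∀ i j, ∀ s ∈ Ioc 0 r, ∀ t ∈ Ioc 0 r, dist (τ i s) (τ j t) = |s - t| → i = j

variable {Γ : Type*} [MetricSpace Γ] {P Q : Γ} {n : ℕ} {r r' : ℝ} {τ : Fin n → ℝ → Γ}

/-- The point at distance `t` on the `k`-th ray of the model star. -/
noncomputable def rayPoint (n : ℕ) (k : ℤ) (t : ℝ) : ℂ :=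
  (t : ℂ) * Complex.exp (2 * (Real.pi : ℂ) * Complex.I * (k : ℂ) / (n : ℂ))

theorem norm_rayDir (n : ℕ) (k : ℤ) :
    ‖Complex.exp (2 * (Real.pi : ℂ) * Complex.I * (k : ℂ) / (n : ℂ))‖ = 1 := by
  rw [show 2 * (Real.pi : ℂ) * Complex.I * (k : ℂ) / (n : ℂ)
      = ((2 * Real.pi * k / n : ℝ) : ℂ) * Complex.I by push_cast; ring]
  exact Complex.norm_exp_ofReal_mul_I _

theorem rayDir_eq_iff {n : ℕ} (hn : 1 ≤ n) (k l : ℤ) :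
    Complex.exp (2 * (Real.pi : ℂ) * Complex.I * (k : ℂ) / (n : ℂ))
      = Complex.exp (2 * (Real.pi : ℂ) * Complex.I * (l : ℂ) / (n : ℂ)) ↔ (n : ℤ) ∣ k - l := by
  have hn' : (n : ℂ) ≠ 0 := by exact_mod_cast (by omega : n ≠ 0)
  have hpi : (2 * (Real.pi : ℂ) * Complex.I) ≠ 0 := Complex.two_pi_I_ne_zero
  rw [Complex.exp_eq_exp_iff_exists_int]
  constructor
  · rintro ⟨m, hm⟩
    refine ⟨m, ?_⟩
    have : (2 * (Real.pi : ℂ) * Complex.I) * k = (2 * (Real.pi : ℂ) * Complex.I) * (l + n * m) := by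
      field_simp at hm
      linear_combination (2 * (Real.pi : ℂ) * Complex.I) * hm
    have := mul_left_cancel₀ hpi this
    have h2 : k = l + n * m := by exact_mod_cast this
    omega
  · rintro ⟨m, hm⟩
    refine ⟨m, ?_⟩
    have h2 : k = l + n * m := by omega
    have h3 : (k : ℂ) = l + n * m := by exact_mod_cast h2
    rw [h3]
    field_simp

theorem norm_rayPoint {t : ℝ} (ht : 0 ≤ t) (n : ℕ) (k : ℤ) : ‖rayPoint n k t‖ = t := by
  rw [rayPoint, norm_mul, norm_rayDir, mul_one, Complex.norm_real, Real.norm_of_nonneg ht]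

theorem dist_rayPoint (n : ℕ) (k : ℤ) (s t : ℝ) :
    dist (rayPoint n k s) (rayPoint n k t) = |s - t| := by
  rw [dist_eq_norm, rayPoint, rayPoint, ← sub_mul, norm_mul, norm_rayDir, mul_one,
    ← Complex.ofReal_sub, Complex.norm_real, Real.norm_eq_abs]

theorem dvd_of_dist_rayPoint {n : ℕ} (hn : 1 ≤ n) {k l : ℤ} {s t : ℝ} (hs : 0 < s) (ht : 0 < t)
    (h : dist (rayPoint n k s) (rayPoint n l t) = |s - t|) : (n : ℤ) ∣ k - l := by
  rw [← rayDir_eq_iff hn]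
  have h1 : SameRay ℝ (rayPoint n k s) (rayPoint n l t) := by
    rw [sameRay_iff_norm_sub, norm_rayPoint hs.le, norm_rayPoint ht.le, ← dist_eq_norm, h]
  have h2 := h1.norm_smul_eq
  rw [norm_rayPoint hs.le, norm_rayPoint ht.le] at h2
  simp only [rayPoint, Complex.real_smul] at h2
  have hs' : (s : ℂ) ≠ 0 := by exact_mod_cast hs.ne'
  have ht' : (t : ℂ) ≠ 0 := by exact_mod_cast ht.ne'
  have h3 : ((s : ℂ) * t) * Complex.exp (2 * (Real.pi : ℂ) * Complex.I * (l : ℂ) / (n : ℂ))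
      = ((s : ℂ) * t) * Complex.exp (2 * (Real.pi : ℂ) * Complex.I * (k : ℂ) / (n : ℂ)) := by
    linear_combination h2
  exact (mul_left_cancel₀ (mul_ne_zero hs' ht') h3).symm

theorem exists_isStar_of_hasStarNbhd (hn : 1 ≤ n) (h : HasStarNbhd Γ P n) :
    ∃ r τ, IsStar P n r τ := by
  obtain ⟨r, hr, U, hU, φ, hφP, hφU, hiso⟩ := h
  obtain ⟨ρ, hρ, hball⟩ := Metric.mem_nhds_iff.1 hU
  have hmem : ∀ (i : Fin n) (t : ℝ), ∃ x, t ∈ Icc 0 r → x ∈ U ∧ φ x = rayPoint n i t := by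
    intro i t
    by_cases ht : t ∈ Icc 0 r
    · have : rayPoint n i t ∈ φ '' U := by
        rw [hφU]
        exact ⟨t, ht, i, rfl⟩
      obtain ⟨x, hx, hx'⟩ := this
      exact ⟨x, fun _ => ⟨hx, hx'⟩⟩
    · exact ⟨P, fun h => absurd h ht⟩
  choose τ hτ using hmem
  have hPU : P ∈ U := mem_of_mem_nhds hU
  have inj : ∀ x ∈ U, ∀ y ∈ U, φ x = φ y → x = y := by
    intro x hx y hy hxy
    rw [← dist_eq_zero, ← hiso x hx y hy, hxy, dist_self]
  have hdist : ∀ i j, ∀ s ∈ Icc 0 r, ∀ t ∈ Icc 0 r,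
      dist (τ i s) (τ j t) = dist (rayPoint n i s) (rayPoint n j t) := by
    intro i j s hs t ht
    rw [← hiso _ (hτ i s hs).1 _ (hτ j t ht).1, (hτ i s hs).2, (hτ j t ht).2]
  have hle : min r ρ ≤ r := min_le_left _ _
  refine ⟨min r ρ, τ, lt_min hr hρ, ?_, ?_, ?_, ?_⟩
  · intro i
    refine inj _ (hτ i 0 ⟨le_rfl, hr.le⟩).1 _ hPU ?_
    rw [(hτ i 0 ⟨le_rfl, hr.le⟩).2, hφP]
    simp [rayPoint]
  · intro i s hs t ht
    rw [hdist i i s ⟨hs.1, hs.2.trans hle⟩ t ⟨ht.1, ht.2.trans hle⟩, dist_rayPoint]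
  · intro x hx
    have hxU : x ∈ U := hball (hx.trans_le (min_le_right _ _))
    have : φ x ∈ starSet n r := hφU ▸ mem_image_of_mem φ hxU
    obtain ⟨t, ht, k, hk⟩ := this
    have hd : dist x P = t := by
      rw [← hiso x hxU P hPU, hφP, dist_zero_right, hk]
      exact norm_rayPoint ht.1 n k
    have hn0 : (0 : ℤ) < n := by omega
    have hk0 := Int.emod_nonneg k hn0.ne'
    have hk1 := Int.emod_lt_of_pos k hn0
    refine ⟨⟨(k % n).toNat, by omega⟩, ?_⟩
    rw [hd]
    refine inj _ hxU _ (hτ _ t ht).1 ?_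
    rw [(hτ _ t ht).2, hk, rayPoint]
    congr 1
    rw [rayDir_eq_iff hn]
    simp only [Int.toNat_of_nonneg hk0]
    exact Int.dvd_self_sub_emod
  · intro i j s hs t ht hst
    rw [hdist i j s ⟨hs.1.le, hs.2.trans hle⟩ t ⟨ht.1.le, ht.2.trans hle⟩] at hst
    have := dvd_of_dist_rayPoint hn hs.1 ht.1 hst
    obtain ⟨m, hm⟩ := this
    have hi := i.2
    have hj := j.2
    have : m = 0 := by
      by_contra hm0
      rcases lt_or_gt_of_ne hm0 with h | h
      · nlinarith
      · nlinarith
    subst this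
    ext
    omega

namespace IsStar

theorem mono (h : IsStar Q n r τ) (h0 : 0 < r') (hr : r' ≤ r) : IsStar Q n r' τ where
  pos := h0
  zero := h.zero
  iso i s hs t ht := h.iso i s ⟨hs.1, hs.2.trans hr⟩ t ⟨ht.1, ht.2.trans hr⟩
  cover x hx := h.cover x (hx.trans_le hr)
  rigid i j s hs t ht := h.rigid i j s ⟨hs.1, hs.2.trans hr⟩ t ⟨ht.1, ht.2.trans hr⟩

theorem dist_center (h : IsStar Q n r τ) (i : Fin n) {t : ℝ} (ht : t ∈ Icc 0 r) :
    dist (τ i t) Q = t := by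
  rw [← h.zero i, h.iso i t ht 0 ⟨le_rfl, h.pos.le⟩, sub_zero, abs_of_nonneg ht.1]

theorem inj (h : IsStar Q n r τ) {i j : Fin n} {s t : ℝ} (hs : s ∈ Ioc 0 r) (ht : t ∈ Icc 0 r)
    (hst : τ i s = τ j t) : i = j ∧ s = t := by
  have e : s = t := by
    rw [← h.dist_center i ⟨hs.1.le, hs.2⟩, hst, h.dist_center j ht]
  subst e
  refine ⟨h.rigid i j s hs s hs ?_, rfl⟩
  rw [hst, dist_self, sub_self, abs_zero]

theorem continuousOn (h : IsStar Q n r τ) (i : Fin n) : ContinuousOn (τ i) (Icc 0 r) := by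
  refine Metric.continuousOn_iff.2 fun s hs ε hε => ⟨ε, hε, fun t ht hts => ?_⟩
  rw [h.iso i t ht s hs]
  exact hts

theorem isArcAt (h : IsStar Q n r τ) (i : Fin n) : IsArcAt Q (τ i) :=
  ⟨h.zero i, r, h.pos, h.iso i⟩

theorem isArcFrame (h : IsStar Q n r τ) : IsArcFrame Q τ := by
  refine ⟨h.isArcAt, ?_, ?_⟩
  · rintro i j hij ⟨ε, hε, he⟩
    have hm : 0 < min ε r := lt_min hε h.pos
    exact hij (h.inj ⟨hm, min_le_right _ _⟩ ⟨hm.le, min_le_right _ _⟩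
      (he _ ⟨hm.le, min_le_left _ _⟩)).1
  · rintro σ ⟨h0, a, ha, hσ⟩
    have hr := h.pos
    set m := min a (r / 2) with hm
    have hm0 : 0 < m := lt_min ha (half_pos h.pos)
    have hma : m ≤ a := min_le_left _ _
    have hmr : m ≤ r / 2 := min_le_right _ _
    have key : ∀ t ∈ Icc 0 m, ∃ i, σ t = τ i t := by
      intro t ht
      have hd : dist (σ t) Q = t := by
        rw [← h0, hσ t ⟨ht.1, ht.2.trans hma⟩ 0 ⟨le_rfl, ha.le⟩, sub_zero, abs_of_nonneg ht.1]
      obtain ⟨i, hi⟩ := h.cover (σ t) (by rw [hd]; linarith [ht.2])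
      exact ⟨i, by rwa [hd] at hi⟩
    obtain ⟨i, hi⟩ := key m ⟨hm0.le, le_rfl⟩
    refine ⟨i, m, hm0, fun t ht => ?_⟩
    rcases ht.1.eq_or_lt with rfl | ht0
    · rw [h0, h.zero]
    obtain ⟨j, hj⟩ := key t ht
    have : j = i := by
      refine h.rigid j i t ⟨ht0, by linarith [ht.2]⟩ m ⟨hm0, by linarith⟩ ?_
      rw [← hi, ← hj, hσ t ⟨ht.1, ht.2.trans hma⟩ m ⟨hm0.le, hma⟩]
    rw [hj, this]

theorem isOpen_ray (h : IsStar Q n r τ) (i : Fin n) {a b : ℝ} (ha : 0 ≤ a) (hb : b ≤ r) :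
    IsOpen (τ i '' Ioo a b) := by
  have hcompact : IsCompact ((⋃ j ∈ {j | j ≠ i}, τ j '' Icc 0 r) ∪
      (τ i '' (Icc 0 a ∩ Icc 0 r) ∪ {Q})) := by
    refine ((Set.toFinite _).isCompact_biUnion fun j _ =>
      isCompact_Icc.image_of_continuousOn (h.continuousOn j)).union
        (IsCompact.union ?_ isCompact_singleton)
    exact (isCompact_Icc.inter isCompact_Icc).image_of_continuousOn
      ((h.continuousOn i).mono inter_subset_right)
  have : τ i '' Ioo a b = Metric.ball Q b ∩
      ((⋃ j ∈ {j | j ≠ i}, τ j '' Icc 0 r) ∪ (τ i '' (Icc 0 a ∩ Icc 0 r) ∪ {Q}))ᶜ := by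
    ext x
    constructor
    · rintro ⟨t, ht, rfl⟩
      have htr : t ∈ Ioc 0 r := ⟨ha.trans_lt ht.1, ht.2.le.trans hb⟩
      refine ⟨?_, ?_⟩
      · rw [Metric.mem_ball, h.dist_center i ⟨htr.1.le, htr.2⟩]
        exact ht.2
      · rintro (hx | ⟨s, hs, hx⟩ | hx)
        · obtain ⟨j, hj, s, hs, hx⟩ := mem_iUnion₂.1 hx
          exact hj (h.inj htr hs hx.symm).1.symm
        · have := (h.inj htr hs.2 hx.symm).2
          linarith [hs.1.2, ht.1]
        · have hd := h.dist_center i ⟨htr.1.le, htr.2⟩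
          rw [mem_singleton_iff.1 hx, dist_self] at hd
          linarith [htr.1]
    · rintro ⟨hx1, hx2⟩
      rw [Metric.mem_ball] at hx1
      obtain ⟨j, hj⟩ := h.cover x (hx1.trans_le hb)
      have hmem : dist x Q ∈ Icc 0 r := ⟨dist_nonneg, (hx1.trans_le hb).le⟩
      have hji : j = i := by
        by_contra hne
        exact hx2 (Or.inl (mem_iUnion₂.2 ⟨j, hne, _, hmem, hj.symm⟩))
      subst hji
      refine ⟨dist x Q, ⟨?_, hx1⟩, hj.symm⟩
      by_contra! hle
      exact hx2 (Or.inr (Or.inl ⟨_, ⟨⟨hmem.1, hle⟩, hmem⟩, hj.symm⟩))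
  rw [this]
  exact Metric.isOpen_ball.inter hcompact.isClosed.isOpen_compl

theorem ray_mem_nhds (h : IsStar Q n r τ) (i : Fin n) {a b t : ℝ} (ha : 0 ≤ a) (hb : b ≤ r)
    (ht : t ∈ Ioo a b) : τ i '' Ioo a b ∈ 𝓝 (τ i t) :=
  (h.isOpen_ray i ha hb).mem_nhds (mem_image_of_mem _ ht)

/-- A point in the interior of a ray is the centre of a star with two rays. -/
theorem interior (h : IsStar Q n r τ) (i : Fin n) {t : ℝ} (ht : t ∈ Ioo 0 r) :
    ∃ ρ, IsStar (τ i t) 2 ρ ![fun u => τ i (t + u), fun u => τ i (t - u)] := by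
  obtain ⟨ρ, hρ, hball⟩ := Metric.mem_nhds_iff.1 (h.ray_mem_nhds i le_rfl le_rfl ht)
  set ρ' := min ρ (min t (r - t)) with hρ'
  have h1 : ρ' ≤ ρ := min_le_left _ _
  have h2 : ρ' ≤ t := (min_le_right _ _).trans (min_le_left _ _)
  have h3 : ρ' ≤ r - t := (min_le_right _ _).trans (min_le_right _ _)
  have h0 : 0 < ρ' := lt_min hρ (lt_min ht.1 (by linarith [ht.2]))
  have hp : ∀ u ∈ Icc 0 ρ', t + u ∈ Icc 0 r := fun u hu =>
    ⟨by linarith [hu.1, ht.1], by linarith [hu.2]⟩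
  have hq : ∀ u ∈ Icc 0 ρ', t - u ∈ Icc 0 r :=
    fun u hu => ⟨by linarith [hu.2], by linarith [hu.1, ht.2]⟩
  refine ⟨ρ', h0, ?_, ?_, ?_, ?_⟩
  · intro k
    fin_cases k <;> simp
  · intro k u hu v hv
    fin_cases k
    · change dist (τ i (t + u)) (τ i (t + v)) = _
      rw [h.iso i _ (hp u hu) _ (hp v hv)]
      congr 1
      ring
    · change dist (τ i (t - u)) (τ i (t - v)) = _
      rw [h.iso i _ (hq u hu) _ (hq v hv), ← abs_neg]
      congr 1
      ring
  · intro x hx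
    obtain ⟨u, hu, rfl⟩ := hball (hx.trans_le h1)
    rw [h.iso i u ⟨hu.1.le, hu.2.le⟩ t ⟨ht.1.le, ht.2.le⟩]
    rcases le_total t u with h | h
    · refine ⟨0, ?_⟩
      rw [abs_of_nonneg (by linarith)]
      simp
    · refine ⟨1, ?_⟩
      rw [abs_of_nonpos (by linarith)]
      simp
  · intro k l u hu v hv
    have hu' : u ∈ Icc 0 ρ' := ⟨hu.1.le, hu.2⟩
    have hv' : v ∈ Icc 0 ρ' := ⟨hv.1.le, hv.2⟩
    have hu0 := hu.1
    have hv0 := hv.1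
    fin_cases k <;> fin_cases l
    · simp
    · change dist (τ i (t + u)) (τ i (t - v)) = _ → _
      rw [h.iso i _ (hp u hu') _ (hq v hv'), abs_of_nonneg (by linarith)]
      intro he
      rcases abs_cases (u - v) with h | h <;> linarith
    · change dist (τ i (t - u)) (τ i (t + v)) = _ → _
      rw [h.iso i _ (hq u hu') _ (hp v hv'), abs_of_nonpos (by linarith)]
      intro he
      rcases abs_cases (u - v) with h | h <;> linarith
    · simp

end IsStar

/-- `f` is affine with integer slopes on the rays of a star at `Q`, the slopes adding up to `m`. -/
def StarOrder (f : Γ → ℝ) (Q : Γ) (m : ℤ) : Prop :=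
  ∃ (n : ℕ) (r : ℝ) (τ : Fin n → ℝ → Γ) (s : Fin n → ℤ), IsStar Q n r τ ∧
    (∀ i, HasSlopeAlong f (τ i) (s i)) ∧ m = ∑ i, s i

variable {f g : Γ → ℝ} {m m' : ℤ}

theorem StarOrder.hasOrderAt (h : StarOrder f Q m) : HasOrderAt Γ f Q m := by
  obtain ⟨n, r, τ, s, h1, h2, rfl⟩ := h
  exact h1.isArcFrame.hasOrderAt h2

theorem IsStar.slope_bounds (h : IsStar Q n r τ) {s : Fin n → ℤ}
    (hs : ∀ i, HasSlopeAlong f (τ i) (s i)) :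
    ∃ ε ∈ Ioc 0 r, ∀ i, ∀ t ∈ Icc 0 ε, f (τ i t) = f Q + s i * t := by
  have : ∀ᶠ t in 𝓝[≥] (0 : ℝ), ∀ i, f (τ i t) = f Q + s i * t := by
    rw [eventually_all]
    intro i
    have := hasSlopeAlong_iff.1 (hs i)
    rwa [h.zero i] at this
  obtain ⟨ε, hε, he⟩ := mem_nhdsGE_iff_exists_Icc_subset.1 this
  refine ⟨min ε r, ⟨lt_min hε h.pos, min_le_right _ _⟩, fun i t ht => ?_⟩
  exact he ⟨ht.1, ht.2.trans (min_le_left _ _)⟩ i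

theorem StarOrder.continuousAt (h : StarOrder f Q m) : ContinuousAt f Q := by
  obtain ⟨n, r, τ, s, h1, h2, rfl⟩ := h
  obtain ⟨ε, hε, he⟩ := h1.slope_bounds h2
  set C : ℝ := ∑ i, |(s i : ℝ)| with hC
  have hC0 : 0 ≤ C := Finset.sum_nonneg fun i _ => abs_nonneg _
  rw [Metric.continuousAt_iff]
  intro η hη
  have hC1 : 0 < C + 1 := by linarith
  refine ⟨min ε (η / (C + 1)), lt_min hε.1 (by positivity), fun x hx => ?_⟩
  have hx1 := hx.trans_le (min_le_left _ _)
  have hx2 := hx.trans_le (min_le_right _ _)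
  obtain ⟨i, hi⟩ := h1.cover x (hx1.trans_le hε.2)
  have hd : (0 : ℝ) ≤ dist x Q := dist_nonneg
  have := he i (dist x Q) ⟨hd, hx1.le⟩
  rw [← hi] at this
  rw [Real.dist_eq, this, add_sub_cancel_left, abs_mul, abs_of_nonneg hd]
  have hle : |(s i : ℝ)| ≤ C :=
    Finset.single_le_sum (f := fun i => |(s i : ℝ)|) (fun i _ => abs_nonneg _) (Finset.mem_univ i)
  rw [lt_div_iff₀ hC1] at hx2
  nlinarith

theorem hasDiv_of_starOrder {E : Divisor Γ} (h : ∀ Q, StarOrder f Q (E Q)) : HasDiv f E := by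
  refine ⟨⟨continuous_iff_continuousAt.2 fun Q => StarOrder.continuousAt (h Q), ?_⟩,
    fun Q => StarOrder.hasOrderAt (h Q)⟩
  intro Q σ hσ
  obtain ⟨n, r, τ, s, h1, h2, -⟩ := h Q
  obtain ⟨i, hi⟩ := h1.isArcFrame.2.2 σ hσ
  exact ⟨s i, slope_congr_arc (h2 i) (arcEquiv_symm hi)⟩

theorem IsStar.starOrder_interior (h : IsStar Q n r τ) (i : Fin n) {t : ℝ} (ht : t ∈ Ioo 0 r)
    {a b : ℤ} (ha : HasSlopeAlong (fun u => f (τ i u)) (fun u => t + u) a)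
    (hb : HasSlopeAlong (fun u => f (τ i u)) (fun u => t - u) b) : StarOrder f (τ i t) (a + b) := by
  obtain ⟨ρ, hρ⟩ := h.interior i ht
  refine ⟨2, ρ, _, ![a, b], hρ, ?_, by simp⟩
  intro k
  fin_cases k
  · exact ha
  · exact hb

theorem finite_of_nhds [CompactSpace Γ] {S : Set Γ} (h : ∀ Q, ∃ V ∈ 𝓝 Q, V ∩ S ⊆ {Q}) :
    S.Finite := by
  choose V hV hVs using h
  obtain ⟨T, hT⟩ := CompactSpace.elim_nhds_subcover V hV
  refine T.finite_toSet.subset fun x hx => ?_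
  have : x ∈ ⋃ y ∈ T, V y := hT ▸ mem_univ x
  obtain ⟨y, hy, hxy⟩ := mem_iUnion₂.1 this
  have : x = y := hVs y ⟨hxy, hx⟩
  rwa [this]

theorem StarOrder.finite_support [CompactSpace Γ] {m : Γ → ℤ} (h : ∀ Q, StarOrder f Q (m Q)) :
    (Function.support m).Finite := by
  refine finite_of_nhds fun Q => ?_
  obtain ⟨n, r, τ, s, h1, h2, -⟩ := h Q
  obtain ⟨ε, hε, he⟩ := h1.slope_bounds h2
  refine ⟨Metric.ball Q ε, Metric.ball_mem_nhds _ hε.1, ?_⟩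
  rintro x ⟨hx, hxm⟩
  by_contra hxQ
  have hx0 : 0 < dist x Q := dist_pos.2 hxQ
  have hx1 : dist x Q < ε := hx
  obtain ⟨i, hi⟩ := h1.cover x (hx1.trans_le hε.2)
  set t := dist x Q with ht
  have h0 : StarOrder f x (s i + -s i) := by
    rw [hi]
    refine h1.starOrder_interior i ⟨hx0, hx1.trans_le hε.2⟩ ?_ ?_
    · refine ⟨ε - t, by linarith, fun u hu => ?_⟩
      simp only [add_zero]
      rw [he i (t + u) ⟨by linarith [hu.1], by linarith [hu.2]⟩, he i t ⟨hx0.le, hx1.le⟩]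
      ring
    · refine ⟨t, hx0, fun u hu => ?_⟩
      simp only [sub_zero]
      rw [he i (t - u) ⟨by linarith [hu.2], by linarith [hu.1]⟩, he i t ⟨hx0.le, hx1.le⟩]
      push_cast
      ring
  have := HasOrderAt.unique (StarOrder.hasOrderAt h0) (StarOrder.hasOrderAt (h x))
  exact hxm (by omega)

/-- A function which is piecewise affine with integer slopes on stars has a divisor. -/
theorem exists_hasDiv [CompactSpace Γ] (h : ∀ Q, ∃ m, StarOrder f Q m) :
    ∃ E : Divisor Γ, HasDiv f E := by
  choose m hm using h
  exact ⟨Finsupp.ofSupportFinite m (StarOrder.finite_support hm), hasDiv_of_starOrder hm⟩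

theorem StarOrder.eq_of_hasDiv {E : Divisor Γ} (h : StarOrder f Q m) (hE : HasDiv f E) :
    E Q = m :=
  HasOrderAt.unique (hE.2 Q) (StarOrder.hasOrderAt h)

theorem HasDiv.exists_slopes {E : Divisor Γ} (hE : HasDiv f E) (h : IsStar Q n r τ) :
    ∃ s : Fin n → ℤ, (∀ i, HasSlopeAlong f (τ i) (s i)) ∧ E Q = ∑ i, s i :=
  h.isArcFrame.exists_slopes (hE.2 Q)

theorem slope_congr {s : ℤ} {σ : ℝ → Γ} (hσ : ContinuousWithinAt σ (Ici 0) 0)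
    (h : HasSlopeAlong f σ s) (e : f =ᶠ[𝓝 (σ 0)] g) : HasSlopeAlong g σ s := by
  rw [hasSlopeAlong_iff] at *
  filter_upwards [h, hσ.eventually e] with t h1 h2
  rw [← h2, h1, e.self_of_nhds]

theorem IsStar.slope_congr_left (h : IsStar Q n r τ) (i : Fin n) {s : ℤ}
    (hs : HasSlopeAlong f (τ i) s) (e : f =ᶠ[𝓝 Q] g) : HasSlopeAlong g (τ i) s := by
  refine slope_congr ?_ hs (by rwa [h.zero i])
  have := h.continuousOn i 0 ⟨le_rfl, h.pos.le⟩
  rwa [continuousWithinAt_Icc_iff_Ici h.pos] at this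

theorem StarOrder.congr (h : StarOrder f Q m) (e : f =ᶠ[𝓝 Q] g) : StarOrder g Q m := by
  obtain ⟨n, r, τ, s, h1, h2, rfl⟩ := h
  exact ⟨n, r, τ, s, h1, fun i => h1.slope_congr_left i (h2 i) e, rfl⟩

theorem IsStar.starOrder_const (h : IsStar Q n r τ) (c : ℝ) (e : ∀ᶠ x in 𝓝 Q, f x = c) :
    StarOrder f Q 0 :=
  StarOrder.congr (f := fun _ => c)
    ⟨n, r, τ, fun _ => 0, h, fun _ => slope_const c, by simp⟩ (e.mono fun x hx => hx.symm)

end Stars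

section Reach

variable {Γ : Type*} [MetricSpace Γ] {P Q S : Γ} {n : ℕ} {r t : ℝ} {τ : Fin n → ℝ → Γ}
  {f g : Γ → ℝ} {E E' : Divisor Γ}

theorem IsStar.starOrder_of_profile (h : IsStar Q n r τ) (i : Fin n) {v : ℝ} (hv : v ∈ Ioo 0 r)
    {φ : ℝ → ℝ} (e : ∀ u ∈ Ioo 0 r, f (τ i u) = φ u) {a b : ℤ}
    (ha : HasSlopeAlong φ (fun u => v + u) a) (hb : HasSlopeAlong φ (fun u => v - u) b) :
    StarOrder f (τ i v) (a + b) := by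
  have hev : φ =ᶠ[𝓝 v] fun u => f (τ i u) := by
    filter_upwards [Ioo_mem_nhds hv.1 hv.2] with u hu using (e u hu).symm
  refine h.starOrder_interior i hv (slope_congr ?_ ha ?_) (slope_congr ?_ hb ?_)
  · exact Continuous.continuousWithinAt (by fun_prop)
  · simpa using hev
  · exact Continuous.continuousWithinAt (by fun_prop)
  · simpa using hev

theorem cone_slopes (t v : ℝ) : ∃ a b : ℤ,
    HasSlopeAlong (fun u => max (t - u) 0) (fun u => v + u) a ∧
    HasSlopeAlong (fun u => max (t - u) 0) (fun u => v - u) b ∧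
    0 ≤ a + b ∧ (v = t → a + b = 1) := by
  rcases lt_trichotomy v t with h | rfl | h
  · refine ⟨-1, 1, ⟨t - v, by linarith, fun u hu => ?_⟩, ⟨t - v, by linarith, fun u hu => ?_⟩,
      by norm_num, fun h' => absurd h' h.ne⟩
    · have := hu.1
      have := hu.2
      simp only
      rw [max_eq_left (by linarith), max_eq_left (by linarith)]
      push_cast
      ring
    · have := hu.1
      simp only
      rw [max_eq_left (by linarith), max_eq_left (by linarith)]
      push_cast
      ring
  · refine ⟨0, 1, ⟨1, one_pos, fun u hu => ?_⟩, ⟨1, one_pos, fun u hu => ?_⟩,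
      by norm_num, fun _ => by norm_num⟩
    · have := hu.1
      simp only
      rw [max_eq_right (by linarith), max_eq_right (by linarith)]
      push_cast
      ring
    · have := hu.1
      simp only
      rw [max_eq_left (by linarith), max_eq_right (by linarith)]
      push_cast
      ring
  · refine ⟨0, 0, ⟨1, one_pos, fun u hu => ?_⟩, ⟨v - t, by linarith, fun u hu => ?_⟩,
      by norm_num, fun h' => absurd h' h.ne'⟩
    · have := hu.1
      simp only
      rw [max_eq_right (by linarith), max_eq_right (by linarith)]
      push_cast
      ring
    · have := hu.1
      have := hu.2
      simp only
      rw [max_eq_right (by linarith), max_eq_right (by linarith)]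
      push_cast
      ring

theorem tent_slopes (ht : 0 < t) {v : ℝ} (hv : 0 < v) : ∃ a b : ℤ,
    HasSlopeAlong (fun u => max (t - |t - u|) 0) (fun u => v + u) a ∧
    HasSlopeAlong (fun u => max (t - |t - u|) 0) (fun u => v - u) b ∧
    (v ≠ t → 0 ≤ a + b) := by
  rcases lt_trichotomy v t with h | rfl | h
  · refine ⟨1, -1, ⟨t - v, by linarith, fun u hu => ?_⟩, ⟨v, by linarith, fun u hu => ?_⟩,
      by norm_num⟩
    all_goals
      have := hu.1
      have := hu.2
      simp only
      rw [abs_of_nonneg (by linarith), abs_of_nonneg (by linarith), max_eq_left (by linarith),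
        max_eq_left (by linarith)]
      push_cast
      ring
  · refine ⟨-1, -1, ⟨v, by linarith, fun u hu => ?_⟩, ⟨v, by linarith, fun u hu => ?_⟩, by simp⟩
    · have := hu.1
      have := hu.2
      simp only
      rw [abs_of_nonpos (by linarith), abs_of_nonneg (by linarith), max_eq_left (by linarith),
        max_eq_left (by linarith)]
      push_cast
      ring
    · have := hu.1
      have := hu.2
      simp only
      rw [abs_of_nonneg (by linarith), abs_of_nonneg (by linarith), max_eq_left (by linarith),
        max_eq_left (by linarith)]
      push_cast
      ring
  · have key : ∀ u, t ≤ u → max (t - |t - u|) 0 = max (2 * t - u) 0 := by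
      intro u hu
      rw [abs_of_nonpos (by linarith)]
      congr 1
      ring
    have hev : (fun u => max (2 * t - u) 0) =ᶠ[𝓝 v] fun u => max (t - |t - u|) 0 := by
      filter_upwards [lt_mem_nhds h] with u hu using (key u hu.le).symm
    obtain ⟨a, b, ha, hb, hab, -⟩ := cone_slopes (2 * t) v
    refine ⟨a, b, slope_congr ?_ ha ?_, slope_congr ?_ hb ?_, fun _ => hab⟩
    · exact Continuous.continuousWithinAt (by fun_prop)
    · simpa using hev
    · exact Continuous.continuousWithinAt (by fun_prop)
    · simpa using hev

theorem hasDiv_zero (hs : ∀ Q : Γ, ∃ n r τ, IsStar Q n r τ) : HasDiv (0 : Γ → ℝ) 0 :=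
  hasDiv_of_starOrder fun Q => by
    obtain ⟨n, r, τ, h⟩ := hs Q
    exact h.starOrder_const 0 (Eventually.of_forall fun _ => rfl)

theorem HasDiv.nsmul (hs : ∀ Q : Γ, ∃ n r τ, IsStar Q n r τ) (h : HasDiv f E) (k : ℕ) :
    HasDiv (k • f) (k • E) := by
  induction k with
  | zero => simpa using hasDiv_zero hs
  | succ k ih => rw [succ_nsmul, succ_nsmul]; exact ih.add h

/-- There is a principal divisor, effective away from `P` and with a chip at `S`. -/
def Reach (P S : Γ) : Prop :=
  ∃ (f : Γ → ℝ) (E : Divisor Γ), HasDiv f E ∧ (∀ x, x ≠ P → 0 ≤ E x) ∧ (S ≠ P → 1 ≤ E S)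

theorem Reach.trans (hs : ∀ Q : Γ, ∃ n r τ, IsStar Q n r τ) (h : Reach P Q) (h' : Reach Q S) :
    Reach P S := by
  rcases eq_or_ne Q P with rfl | hQP
  · exact h'
  rcases eq_or_ne S Q with rfl | hSQ
  · exact h
  obtain ⟨f, E, h1, h2, h3⟩ := h
  obtain ⟨g, E', h1', h2', h3'⟩ := h'
  refine ⟨_, _, h1'.add (h1.nsmul hs (E' Q).natAbs), fun x hx => ?_, fun hSP => ?_⟩
  · simp only [Finsupp.add_apply, Finsupp.smul_apply, nsmul_eq_mul]
    rcases eq_or_ne x Q with rfl | hxQ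
    · have := h3 hQP
      have h4 : |E' x| ≤ |E' x| * E x := le_mul_of_one_le_right (abs_nonneg _) this
      have := neg_abs_le (E' x)
      rw [Int.natCast_natAbs]
      linarith
    · have := h2' x hxQ
      have := mul_nonneg (Int.natCast_nonneg (E' Q).natAbs) (h2 x hx)
      linarith
  · simp only [Finsupp.add_apply, Finsupp.smul_apply, nsmul_eq_mul]
    have := h3' hSQ
    have := mul_nonneg (Int.natCast_nonneg (E' Q).natAbs) (h2 S hSP)
    linarith

/-- The divisor of the cone function of height `t` at the centre of a star. -/
theorem IsStar.exists_cone [CompactSpace Γ] (hs : ∀ Q : Γ, ∃ n r τ, IsStar Q n r τ)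
    (h : IsStar P n r τ) (ht : t ∈ Ioo 0 r) :
    ∃ (f : Γ → ℝ) (E : Divisor Γ), HasDiv f E ∧ (∀ x, x ≠ P → 0 ≤ E x) ∧
      (∀ i, E (τ i t) = 1) ∧ E P = -n := by
  set f : Γ → ℝ := fun x => max (t - dist x P) 0 with hf
  have hP : StarOrder f P (-n) := by
    refine ⟨n, r, τ, fun _ => -1, h, fun i => ⟨t, ht.1, fun u hu => ?_⟩, by simp⟩
    simp only [hf]
    rw [h.dist_center i ⟨hu.1, hu.2.trans ht.2.le⟩, h.zero, dist_self,
      max_eq_left (by linarith [hu.2]),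
      max_eq_left (by linarith [ht.1])]
    push_cast
    ring
  have hray : ∀ i, ∀ v ∈ Ioo 0 r, ∃ m, StarOrder f (τ i v) m ∧ 0 ≤ m ∧ (v = t → m = 1) := by
    intro i v hv
    obtain ⟨a, b, ha, hb, h1, h2⟩ := cone_slopes t v
    refine ⟨a + b, h.starOrder_of_profile i hv (fun u hu => ?_) ha hb, h1, h2⟩
    simp only [hf]
    rw [h.dist_center i ⟨hu.1.le, hu.2.le⟩]
  have hall : ∀ x, x ≠ P → ∃ m, StarOrder f x m ∧ 0 ≤ m := by
    intro x hx
    rcases lt_or_ge (dist x P) r with hd | hd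
    · obtain ⟨i, hi⟩ := h.cover x hd
      obtain ⟨m, h1, h2, -⟩ := hray i _ ⟨dist_pos.2 hx, hd⟩
      rw [hi]
      exact ⟨m, h1, h2⟩
    · obtain ⟨k, ρ, σ, hσ⟩ := hs x
      refine ⟨0, hσ.starOrder_const 0 ?_, le_rfl⟩
      have hc : Continuous fun y => dist y P := by fun_prop
      filter_upwards [hc.continuousAt.eventually (lt_mem_nhds (ht.2.trans_le hd))] with y hy
      exact max_eq_right (by linarith)
  obtain ⟨E, hE⟩ : ∃ E : Divisor Γ, HasDiv f E := by
    refine exists_hasDiv fun Q => ?_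
    rcases eq_or_ne Q P with rfl | hQ
    · exact ⟨_, hP⟩
    · obtain ⟨m, hm, -⟩ := hall Q hQ
      exact ⟨m, hm⟩
  refine ⟨f, E, hE, fun x hx => ?_, fun i => ?_, StarOrder.eq_of_hasDiv hP hE⟩
  · obtain ⟨m, hm, h0⟩ := hall x hx
    rwa [StarOrder.eq_of_hasDiv hm hE]
  · obtain ⟨m, hm, -, h1⟩ := hray i t ht
    rw [StarOrder.eq_of_hasDiv hm hE, h1 rfl]

/-- The divisor of a tent function supported on one ray of a star. -/
theorem IsStar.exists_tent [CompactSpace Γ] (hs : ∀ Q : Γ, ∃ n r τ, IsStar Q n r τ)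
    (h : IsStar P n r τ) (j : Fin n) (ht : 0 < t) (htr : 2 * t < r) :
    ∃ (f : Γ → ℝ) (E : Divisor Γ), HasDiv f E ∧ (∀ x, x ≠ τ j t → 0 ≤ E x) ∧ E P = 1 := by
  classical
  set f : Γ → ℝ := fun x => if x ∈ τ j '' Ioo 0 r then max (t - |t - dist x P|) 0 else 0 with hf
  have hfj : ∀ u ∈ Ioo 0 r, f (τ j u) = max (t - |t - u|) 0 := by
    intro u hu
    simp only [hf]
    rw [if_pos (mem_image_of_mem _ hu), h.dist_center j ⟨hu.1.le, hu.2.le⟩]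
  have hfi : ∀ i, i ≠ j → ∀ u ∈ Ioo 0 r, f (τ i u) = 0 := by
    intro i hij u hu
    simp only [hf]
    rw [if_neg]
    rintro ⟨v, hv, he⟩
    exact hij (h.inj ⟨hv.1, hv.2.le⟩ ⟨hu.1.le, hu.2.le⟩ he).1.symm
  have hfP : f P = 0 := by
    simp only [hf]
    rw [if_neg]
    rintro ⟨v, hv, he⟩
    have := h.dist_center j ⟨hv.1.le, hv.2.le⟩
    rw [he, dist_self] at this
    exact hv.1.ne this
  have hP : StarOrder f P 1 := by
    refine ⟨n, r, τ, fun i => if i = j then 1 else 0, h, fun i => ⟨t, ht, fun u hu => ?_⟩, by simp⟩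
    rw [h.zero, hfP]
    rcases hu.1.eq_or_lt with rfl | hu0
    · simp [h.zero, hfP]
    have hur : u ∈ Ioo 0 r := ⟨hu0, by linarith [hu.2]⟩
    change f (τ i u) = 0 + ((if i = j then 1 else 0 : ℤ) : ℝ) * u
    split_ifs with hij
    · subst hij
      rw [hfj u hur, abs_of_nonneg (by linarith [hu.2]), max_eq_left (by linarith)]
      push_cast
      ring
    · rw [hfi i hij u hur]
      simp
  have hall : ∀ x, ∃ m, StarOrder f x m ∧ (x ≠ τ j t → 0 ≤ m) := by
    intro x
    rcases eq_or_ne x P with rfl | hx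
    · exact ⟨1, hP, fun _ => zero_le_one⟩
    rcases lt_or_ge (dist x P) r with hd | hd
    · obtain ⟨i, hi⟩ := h.cover x hd
      have hv : dist x P ∈ Ioo 0 r := ⟨dist_pos.2 hx, hd⟩
      set v := dist x P
      rw [hi]
      by_cases hij : i = j
      · subst hij
        obtain ⟨a, b, ha, hb, h1⟩ := tent_slopes ht hv.1
        refine ⟨a + b, h.starOrder_of_profile i hv hfj ha hb, fun hne => h1 ?_⟩
        rintro hvt
        rw [hvt] at hne
        exact hne rfl
      · refine ⟨0 + 0, h.starOrder_of_profile i hv (hfi i hij) (slope_const 0) (slope_const 0),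
          fun _ => le_rfl⟩
    · obtain ⟨k, ρ, σ, hσ⟩ := hs x
      refine ⟨0, hσ.starOrder_const 0 ?_, fun _ => le_rfl⟩
      have hc : Continuous fun y => dist y P := by fun_prop
      filter_upwards [hc.continuousAt.eventually (lt_mem_nhds (htr.trans_le hd))] with y hy
      simp only [hf]
      split_ifs
      · rw [abs_of_nonpos (by linarith)]
        exact max_eq_right (by linarith)
      · rfl
  obtain ⟨E, hE⟩ : ∃ E : Divisor Γ, HasDiv f E :=
    exists_hasDiv fun Q => (hall Q).imp fun m hm => hm.1
  refine ⟨f, E, hE, fun x hx => ?_, StarOrder.eq_of_hasDiv hP hE⟩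
  obtain ⟨m, hm, h0⟩ := hall x
  rw [StarOrder.eq_of_hasDiv hm hE]
  exact h0 hx

theorem eventually_reach [CompactSpace Γ] (hs : ∀ Q : Γ, ∃ n r τ, IsStar Q n r τ) (P : Γ) :
    ∀ᶠ Q in 𝓝 P, Reach P Q ∧ Reach Q P := by
  obtain ⟨n, r, τ, h⟩ := hs P
  have hr := h.pos
  filter_upwards [Metric.ball_mem_nhds P (half_pos h.pos)] with Q hQ
  rw [Metric.mem_ball] at hQ
  rcases eq_or_ne Q P with rfl | hne
  · have : Reach Q Q := ⟨0, 0, hasDiv_zero hs, by simp, by simp⟩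
    exact ⟨this, this⟩
  have ht : 0 < dist Q P := dist_pos.2 hne
  obtain ⟨j, hj⟩ := h.cover Q (by linarith)
  set t := dist Q P
  obtain ⟨f, E, h1, h2, h3, h4⟩ := h.exists_cone hs (t := t) ⟨ht, by linarith⟩
  obtain ⟨g, E', h1', h2', h3'⟩ := h.exists_tent hs j ht (by linarith)
  rw [← hj] at h2'
  refine ⟨⟨f, E, h1, h2, fun _ => ?_⟩,
    ⟨_, _, h1.add (h1'.nsmul hs (n + 1)), fun x hx => ?_, fun _ => ?_⟩⟩
  · rw [hj, h3]
  · simp only [Finsupp.add_apply, Finsupp.smul_apply, nsmul_eq_mul]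
    rcases eq_or_ne x P with rfl | hxP
    · rw [h4, h3']
      push_cast
      omega
    · exact add_nonneg (h2 x hxP) (mul_nonneg (Int.natCast_nonneg _) (h2' x hx))
  · simp only [Finsupp.add_apply, Finsupp.smul_apply, nsmul_eq_mul]
    rw [h4, h3']
    push_cast
    omega

theorem reach [CompactSpace Γ] [ConnectedSpace Γ] (hs : ∀ Q : Γ, ∃ n r τ, IsStar Q n r τ)
    (P Q : Γ) : Reach P Q :=
  PreconnectedSpace.induction₂' Reach (eventually_reach hs) ⟨fun _ _ _ => Reach.trans hs⟩ P Q

/-- Every divisor is equivalent to one which is effective away from `P`. -/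
theorem exists_effective_away [CompactSpace Γ] [ConnectedSpace Γ]
    (hs : ∀ Q : Γ, ∃ n r τ, IsStar Q n r τ) (P : Γ) (D : Divisor Γ) :
    ∃ f E, HasDiv f E ∧ ∀ x, x ≠ P → 0 ≤ D x + E x := by
  induction D using Finsupp.induction_linear with
  | zero => exact ⟨0, 0, hasDiv_zero hs, by simp⟩
  | add D D' h h' =>
    obtain ⟨f, E, h1, h2⟩ := h
    obtain ⟨f', E', h1', h2'⟩ := h'
    refine ⟨_, _, h1.add h1', fun x hx => ?_⟩
    have := h2 x hx
    have := h2' x hx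
    simp only [Finsupp.coe_add, Pi.add_apply]
    linarith
  | single Q m =>
    obtain ⟨f, E, h1, h2, h3⟩ := reach hs P Q
    refine ⟨_, _, h1.nsmul hs m.natAbs, fun x hx => ?_⟩
    simp only [Finsupp.smul_apply, nsmul_eq_mul]
    rcases eq_or_ne x Q with rfl | hxQ
    · have h4 : |m| ≤ |m| * E x := le_mul_of_one_le_right (abs_nonneg _) (h3 hx)
      have := neg_abs_le m
      rw [Int.natCast_natAbs, Finsupp.single_eq_same]
      linarith
    · rw [Finsupp.single_eq_of_ne hxQ, zero_add]
      exact mul_nonneg (Int.natCast_nonneg _) (h2 x hx)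

end Reach

section Convexity

variable {h : ℝ → ℝ} {r t u : ℝ}

/-- A continuous piecewise affine function whose slopes increase is convex. -/
theorem convexOn_of_slopes (hc : ContinuousOn h (Icc 0 r))
    (hs : ∀ t ∈ Ioo 0 r, ∃ a b : ℤ, HasSlopeAlong h (fun u => t + u) a ∧
      HasSlopeAlong h (fun u => t - u) b ∧ 0 ≤ a + b) : ConvexOn ℝ (Icc 0 r) h := by
  refine LinearOrder.convexOn_of_lt (convex_Icc 0 r) fun x hx y hy hxy α β hα hβ hαβ => ?_
  simp only [smul_eq_mul]
  by_contra! hlt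
  have hyx : 0 < y - x := sub_pos.2 hxy
  set k := (h y - h x) / (y - x) with hk
  have hkm : k * (y - x) = h y - h x := div_mul_cancel₀ _ hyx.ne'
  set g : ℝ → ℝ := fun u => h u - (h x + k * (u - x)) with hg
  have hsub : Icc x y ⊆ Icc 0 r := Icc_subset_Icc hx.1 hy.2
  have hgc : ContinuousOn g (Icc x y) := (hc.mono hsub).sub (by fun_prop)
  obtain ⟨c₀, hc₀, hmax⟩ := isCompact_Icc.exists_isMaxOn ⟨x, left_mem_Icc.2 hxy.le⟩ hgc
  have hK : IsCompact (Icc x y ∩ g ⁻¹' {g c₀}) :=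
    isCompact_Icc.of_isClosed_subset (hgc.preimage_isClosed_of_isClosed isClosed_Icc
      isClosed_singleton) inter_subset_left
  obtain ⟨c, hcm, hcg⟩ := hK.exists_isGreatest ⟨c₀, hc₀, rfl⟩
  have hcmax : ∀ v ∈ Icc x y, g v ≤ g c := fun v hv => by
    rw [show g c = g c₀ from hcm.2]
    exact hmax hv
  have hclast : ∀ v ∈ Icc x y, c < v → g v < g c := fun v hv hcv => by
    refine lt_of_le_of_ne (hcmax v hv) fun he => ?_
    exact (hcg ⟨hv, he.trans hcm.2⟩).not_gt hcv
  have hβ1 : β = 1 - α := by linarith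
  have hz : α * x + β * y ∈ Icc x y := by
    have h1 := mul_pos hα hyx
    have h2 := mul_pos hβ hyx
    subst hβ1
    constructor <;> linarith
  have hgz : 0 < g (α * x + β * y) := by
    simp only [hg]
    have : h x + k * (α * x + β * y - x) = α * h x + β * h y := by
      rw [hβ1]
      linear_combination (1 - α) * hkm
    linarith
  have hgcpos := hgz.trans_le (hcmax _ hz)
  have hgx : g x = 0 := by simp [hg]
  have hgy : g y = 0 := by simp only [hg]; linarith
  have hxc : x < c := lt_of_le_of_ne hcm.1.1 fun he => by rw [← he] at hgcpos; linarith
  have hcy : c < y := lt_of_le_of_ne hcm.1.2 fun he => by rw [he] at hgcpos; linarith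
  obtain ⟨a, b, ⟨ε, hε, ha⟩, ⟨δ, hδ, hb⟩, hab⟩ :=
    hs c ⟨hx.1.trans_lt hxc, hcy.trans_le hy.2⟩
  set v := min (min ε δ) (min (c - x) (y - c)) with hv
  have hv0 : 0 < v := lt_min (lt_min hε hδ) (lt_min (by linarith) (by linarith))
  have hvε : v ≤ ε := (min_le_left _ _).trans (min_le_left _ _)
  have hvδ : v ≤ δ := (min_le_left _ _).trans (min_le_right _ _)
  have hvx : v ≤ c - x := (min_le_right _ _).trans (min_le_left _ _)
  have hvy : v ≤ y - c := (min_le_right _ _).trans (min_le_right _ _)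
  have h1 := ha v ⟨hv0.le, hvε⟩
  have h2 := hb v ⟨hv0.le, hvδ⟩
  have h3 := hclast (c + v) ⟨by linarith, by linarith⟩ (by linarith)
  have h4 := hcmax (c - v) ⟨by linarith, by linarith⟩
  simp only [hg, add_zero, sub_zero] at h1 h2 h3 h4
  have hab' : (0 : ℝ) ≤ a + b := by exact_mod_cast hab
  have h5 : 0 ≤ ((a : ℝ) + b) * v := mul_nonneg hab' hv0.le
  linarith

theorem ConvexOn.support_line (hc : ConvexOn ℝ (Icc 0 r) h) {a : ℤ} (ht : t ∈ Ico 0 r)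
    (ha : HasSlopeAlong h (fun u => t + u) a) (hu : u ∈ Icc 0 r) : h t + a * (u - t) ≤ h u := by
  obtain ⟨ε, hε, ha⟩ := ha
  simp only [add_zero] at ha
  rcases lt_trichotomy u t with hut | rfl | hut
  · set v := min ε (r - t)
    have hv0 : 0 < v := lt_min hε (by linarith [ht.2])
    have hvr : v ≤ r - t := min_le_right _ _
    have := hc.slope_mono_adjacent hu (z := t + v) ⟨by linarith [ht.1], by linarith⟩ hut
      (by linarith)
    rw [ha v ⟨hv0.le, min_le_left _ _⟩, div_le_iff₀ (by linarith),
      show (h t + a * v - h t) / (t + v - t) = a by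
        rw [add_sub_cancel_left, add_sub_cancel_left, mul_div_cancel_right₀ _ hv0.ne']] at this
    linarith
  · simp
  · set v := min ε ((u - t) / 2)
    have hv0 : 0 < v := lt_min hε (by linarith)
    have hvr : v ≤ (u - t) / 2 := min_le_right _ _
    have := hc.slope_mono_adjacent ⟨ht.1, ht.2.le⟩ hu (y := t + v) (by linarith) (by linarith)
    rw [ha v ⟨hv0.le, min_le_left _ _⟩, le_div_iff₀ (by linarith),
      show (h t + a * v - h t) / (t + v - t) = a by
        rw [add_sub_cancel_left, add_sub_cancel_left, mul_div_cancel_right₀ _ hv0.ne']] at this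
    linarith

theorem slope_max {Γ : Type*} {f g : Γ → ℝ} {τ : ℝ → Γ} {s s' : ℤ} (h : HasSlopeAlong f τ s)
    (h' : HasSlopeAlong g τ s') : ∃ m, HasSlopeAlong (f ⊔ g) τ m := by
  have key : ∀ {f g : Γ → ℝ} {s s' : ℤ}, HasSlopeAlong f τ s → HasSlopeAlong g τ s' →
      g (τ 0) < f (τ 0) → HasSlopeAlong (f ⊔ g) τ s := by
    intro f g s s' h h' hlt
    rw [hasSlopeAlong_iff] at *
    have hcont : ContinuousAt (fun t : ℝ => f (τ 0) + s * t - (g (τ 0) + s' * t)) 0 := by fun_prop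
    have hev := (hcont.eventually (lt_mem_nhds (a := 0) (by simpa using hlt))).filter_mono
      (nhdsWithin_le_nhds (s := Ici 0))
    filter_upwards [h, h', hev] with t h1 h2 h3
    rw [Pi.sup_apply, Pi.sup_apply, sup_eq_left.2 hlt.le, sup_eq_left.2 (by linarith), h1]
  rcases lt_trichotomy (g (τ 0)) (f (τ 0)) with hlt | heq | hlt
  · exact ⟨s, key h h' hlt⟩
  · refine ⟨max s s', ?_⟩
    rw [hasSlopeAlong_iff] at *
    filter_upwards [h, h', self_mem_nhdsWithin] with t h1 h2 h3
    rw [Pi.sup_apply, Pi.sup_apply, h1, h2, heq, sup_idem, Int.cast_max, max_mul_of_nonneg _ _ h3,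
      max_add_add_left]
  · rw [sup_comm]
    exact ⟨s', key h' h hlt⟩

/-- The supremum of a family of functions, all of which have support lines with bounded integer
slopes, is affine with integer slope near `0`. -/
theorem exists_slope_of_isLUB {A : Set (ℝ → ℝ)} {F : ℝ → ℝ} {ρ : ℝ} {N : ℕ} (hρ : 0 < ρ)
    (hA : A.Nonempty) (hF : ∀ t ∈ Icc 0 ρ, IsLUB ((fun h : ℝ → ℝ => h t) '' A) (F t))
    (h0 : ∀ h ∈ A, ∀ t ∈ Icc 0 ρ, 0 ≤ h t)
    (hs : ∀ h ∈ A, ∀ t ∈ Icc 0 ρ, ∃ a : ℤ, |a| ≤ N ∧ ∀ u ∈ Icc 0 ρ, h t + a * (u - t) ≤ h u) :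
    ∃ s, HasSlopeAlong F (fun t => t) s := by
  set T : ℤ → Set ℝ := fun k => {b | ∃ h ∈ A, ∀ u ∈ Icc 0 ρ, b + k * u ≤ h u} with hT
  set B : ℤ → ℝ := fun k => sSup (T k) with hB
  have hle : ∀ k, ∀ b ∈ T k, ∀ t ∈ Icc 0 ρ, b ≤ F t - k * t := by
    rintro k b ⟨h, hh, hb⟩ t ht
    have h1 : h t ≤ F t := (hF t ht).1 (mem_image_of_mem _ hh)
    linarith [hb t ht]
  have hne : ∀ k, (T k).Nonempty := by
    intro k
    obtain ⟨h, hh⟩ := hA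
    refine ⟨-|(k : ℝ)| * ρ, h, hh, fun u hu => ?_⟩
    have h1 := h0 h hh u hu
    have h2 : (k : ℝ) * u ≤ |(k : ℝ)| * ρ :=
      mul_le_mul (le_abs_self _) hu.2 hu.1 (abs_nonneg _)
    linarith
  have hbdd : ∀ k, BddAbove (T k) := fun k => ⟨_, fun b hb => hle k b hb 0 ⟨le_rfl, hρ.le⟩⟩
  have hS : (Finset.Icc (-(N : ℤ)) N).Nonempty := ⟨0, by simp⟩
  set G : ℝ → ℝ := (Finset.Icc (-(N : ℤ)) N).sup' hS fun k t => B k + k * t with hG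
  have hFG : ∀ t ∈ Icc 0 ρ, F t = G t := by
    intro t ht
    rw [hG, Finset.sup'_apply]
    apply le_antisymm
    · refine (hF t ht).2 ?_
      rintro _ ⟨h, hh, rfl⟩
      obtain ⟨a, haN, ha⟩ := hs h hh t ht
      have hmem : h t - a * t ∈ T a := ⟨h, hh, fun u hu => by linarith [ha u hu]⟩
      have h1 := le_csSup (hbdd a) hmem
      have h2 := Finset.le_sup' (fun k : ℤ => B k + k * t) (Finset.mem_Icc.2 (abs_le.1 haN))
      simp only [hB] at h1 h2 ⊢
      linarith
    · refine Finset.sup'_le _ _ fun k _ => ?_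
      have := csSup_le (hne k) fun b hb => hle k b hb t ht
      simp only [hB]
      linarith
  have hGs : ∃ s, HasSlopeAlong G (fun t => t) s := by
    refine Finset.sup'_induction hS _ (p := fun φ : ℝ → ℝ => ∃ s, HasSlopeAlong φ (fun t => t) s)
      ?_ ?_
    · rintro φ ⟨s, h⟩ ψ ⟨s', h'⟩
      exact slope_max h h'
    · intro k _
      exact ⟨k, 1, one_pos, fun t _ => by simp⟩
  obtain ⟨s, hGs⟩ := hGs
  refine ⟨s, ?_⟩
  rw [hasSlopeAlong_iff] at *
  filter_upwards [hGs, Icc_mem_nhdsGE hρ] with t h1 h2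
  rw [hFG t h2, hFG 0 ⟨le_rfl, hρ.le⟩, h1]

end Convexity

section Perron

variable {Γ : Type*} [MetricSpace Γ]

/-- The competitors for the maximum: nonnegative, normalized at `P`, and keeping `D` effective away
from `P`. -/
def Admissible (D : Divisor Γ) (P : Γ) (f : Γ → ℝ) : Prop :=
  ∃ E, HasDiv f E ∧ (∀ x, 0 ≤ f x) ∧ f P = 0 ∧ ∀ x, x ≠ P → 0 ≤ D x + E x

variable {D : Divisor Γ} {P Q : Γ} {n : ℕ} {r : ℝ} {τ : Fin n → ℝ → Γ} {f : Γ → ℝ}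

theorem Admissible.order_bounds (hD : ∀ x, x ≠ P → 0 ≤ D x) (hf : Admissible D P f) :
    ∃ E, HasDiv f E ∧ ∀ x, -|D x| ≤ E x ∧ (x ≠ P → -D x ≤ E x) := by
  obtain ⟨E, hE, h0, hP, hDE⟩ := hf
  refine ⟨E, hE, fun x => ?_⟩
  rcases eq_or_ne x P with rfl | hx
  · have : 0 ≤ E x := by
      obtain ⟨n, τ, hτ⟩ := HasOrderAt.frame (hE.2 x)
      obtain ⟨s, hs, he⟩ := hτ.exists_slopes (hE.2 x)
      rw [he]
      refine Finset.sum_nonneg fun i _ => slope_nonneg (hs i) fun y => ?_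
      rw [(hτ.1 i).1, hP]
      exact h0 y
    exact ⟨by linarith [abs_nonneg (D x)], fun h => absurd rfl h⟩
  · have := hDE x hx
    rw [abs_of_nonneg (hD x hx)]
    exact ⟨by linarith, fun _ => by linarith⟩

theorem exists_isolating_star (hs : ∀ Q : Γ, ∃ n r τ, IsStar Q n r τ) (D : Divisor Γ) (Q : Γ) :
    ∃ n r τ, IsStar Q n r τ ∧ ∀ x, x ≠ Q → dist x Q ≤ r → D x = 0 := by
  obtain ⟨n, r, τ, h⟩ := hs Q
  have hfin : ((D.support : Set Γ) \ {Q}).Finite := D.support.finite_toSet.sdiff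
  have hmem : ((D.support : Set Γ) \ {Q})ᶜ ∈ 𝓝 Q := hfin.isClosed.isOpen_compl.mem_nhds (by simp)
  obtain ⟨ρ, hρ, hball⟩ := Metric.mem_nhds_iff.1 hmem
  refine ⟨n, min r (ρ / 2), τ, h.mono (lt_min h.pos (half_pos hρ)) (min_le_left _ _), ?_⟩
  intro x hx hd
  have : x ∈ Metric.ball Q ρ := by
    rw [Metric.mem_ball]
    linarith [hd.trans (min_le_right _ _)]
  by_contra h0
  exact hball this ⟨by simpa using h0, hx⟩

theorem Admissible.convexOn (hD : ∀ x, x ≠ P → 0 ≤ D x) (hf : Admissible D P f)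
    (h : IsStar Q n r τ) (hiso : ∀ x, x ≠ Q → dist x Q ≤ r → D x = 0) (i : Fin n) :
    ConvexOn ℝ (Icc 0 r) fun t => f (τ i t) := by
  obtain ⟨E, hE, hbd⟩ := hf.order_bounds hD
  refine convexOn_of_slopes (hE.1.1.comp_continuousOn (h.continuousOn i)) fun t ht => ?_
  obtain ⟨ρ, hρ⟩ := h.interior i ht
  obtain ⟨s, hs, he⟩ := hE.exists_slopes hρ
  refine ⟨s 0, s 1, hs 0, hs 1, ?_⟩
  have hd := h.dist_center i ⟨ht.1.le, ht.2.le⟩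
  have hne : τ i t ≠ Q := by
    intro hQ
    rw [hQ, dist_self] at hd
    exact ht.1.ne hd
  have := (hbd (τ i t)).1
  rw [hiso _ hne (by rw [hd]; exact ht.2.le), he, Fin.sum_univ_two] at this
  simpa using this

/-- The slopes at the centre of a star give support lines, and are bounded in terms of the
distance to an upper bound. -/
theorem Admissible.center_slopes (hD : ∀ x, x ≠ P → 0 ≤ D x) (hf : Admissible D P f)
    (h : IsStar Q n r τ) (hiso : ∀ x, x ≠ Q → dist x Q ≤ r → D x = 0) {M : ℝ}
    (hM : ∀ x, f x ≤ M) :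
    ∃ s : Fin n → ℤ, (∀ i, HasSlopeAlong f (τ i) (s i)) ∧ (Q ≠ P → -D Q ≤ ∑ i, s i) ∧
      (∀ i, ∀ t ∈ Icc 0 r, f Q + s i * t ≤ f (τ i t)) ∧
      ∀ i, -(|(D Q : ℝ)| * r + n * (M - f Q)) ≤ s i * r := by
  obtain ⟨E, hE, hbd⟩ := hf.order_bounds hD
  obtain ⟨s, hs, he⟩ := hE.exists_slopes h
  have hsup : ∀ i, ∀ t ∈ Icc 0 r, f Q + s i * t ≤ f (τ i t) := by
    intro i t ht
    have h1 : HasSlopeAlong (fun t => f (τ i t)) (fun u => 0 + u) (s i) := by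
      simp only [zero_add]
      exact hs i
    have := ConvexOn.support_line (hf.convexOn hD h hiso i) ⟨le_rfl, h.pos⟩ h1 ht
    simpa only [h.zero, sub_zero] using this
  have hup : ∀ i, s i * r ≤ M - f Q := fun i => by
    linarith [hsup i r ⟨h.pos.le, le_rfl⟩, hM (τ i r)]
  refine ⟨s, hs, fun hQ => he ▸ (hbd Q).2 hQ, hsup, fun i => ?_⟩
  have h1 : -|(D Q : ℝ)| ≤ ∑ j, (s j : ℝ) := by
    have := (hbd Q).1
    rw [he] at this
    exact_mod_cast this
  have h2 : ∑ j, (s j : ℝ) * r = s i * r + ∑ j ∈ Finset.univ.erase i, (s j : ℝ) * r :=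
    (Finset.add_sum_erase _ _ (Finset.mem_univ i)).symm
  have h3 : ∑ j ∈ Finset.univ.erase i, (s j : ℝ) * r ≤ ∑ j ∈ Finset.univ.erase i, (M - f Q) :=
    Finset.sum_le_sum fun j _ => hup j
  have hA : 0 ≤ M - f Q := sub_nonneg.2 (hM Q)
  have h4 : ∑ j ∈ Finset.univ.erase i, (M - f Q) ≤ n * (M - f Q) := by
    rw [Finset.sum_const, nsmul_eq_mul]
    refine mul_le_mul_of_nonneg_right ?_ hA
    have := Finset.card_le_univ (Finset.univ.erase i)
    rw [Fintype.card_fin] at this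
    exact_mod_cast this
  rw [← Finset.sum_mul] at h2
  have h5 := mul_le_mul_of_nonneg_right h1 h.pos.le
  linarith

/-- A Harnack inequality for `M - f`, uniform in the admissible function `f`. -/
theorem harnack (hs : ∀ Q : Γ, ∃ n r τ, IsStar Q n r τ) (hD : ∀ x, x ≠ P → 0 ≤ D x) (Q : Γ) :
    ∃ V ∈ 𝓝 Q, ∃ K : ℝ, 0 ≤ K ∧ ∀ f, Admissible D P f → ∀ M, (∀ x, f x ≤ M) → ∀ x ∈ V,
      1 + (M - f Q) ≤ K * (1 + (M - f x)) ∧ 1 + (M - f x) ≤ K * (1 + (M - f Q)) := by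
  obtain ⟨n, r, τ, h, hiso⟩ := exists_isolating_star hs D Q
  have hr := h.pos
  have hd0 := mul_nonneg (abs_nonneg (D Q : ℝ)) hr.le
  have hn0 : (0 : ℝ) ≤ n := n.cast_nonneg
  refine ⟨Metric.ball Q (r / 2), Metric.ball_mem_nhds _ (half_pos hr), n + 2 + |(D Q : ℝ)| * r,
    by positivity, fun f hf M hM x hx => ?_⟩
  rw [Metric.mem_ball] at hx
  obtain ⟨i, hi⟩ := h.cover x (by linarith)
  have ht0 : 0 ≤ dist x Q := dist_nonneg
  set t := dist x Q
  have hA : 0 ≤ M - f Q := sub_nonneg.2 (hM Q)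
  have hx0 : 0 ≤ M - f x := sub_nonneg.2 (hM x)
  have hnA := mul_nonneg hn0 hA
  have hnx := mul_nonneg hn0 hx0
  have hdA := mul_nonneg hd0 hA
  have hdx := mul_nonneg hd0 hx0
  constructor
  · have hle : t / r ≤ 1 := by rw [div_le_one hr]; linarith
    have hconv := (hf.convexOn hD h hiso i).2 (left_mem_Icc.2 hr.le) (right_mem_Icc.2 hr.le)
      (sub_nonneg.2 hle) (div_nonneg ht0 hr.le) (sub_add_cancel _ _)
    simp only [smul_eq_mul, mul_zero, zero_add, div_mul_cancel₀ _ hr.ne', h.zero, ← hi] at hconv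
    have h1 := mul_le_mul_of_nonneg_left (hM (τ i r)) (div_nonneg ht0 hr.le)
    have h2 : t / r ≤ 1 / 2 := by rw [div_le_iff₀ hr]; linarith
    have h3 := mul_nonneg (sub_nonneg.2 h2) hA
    nlinarith
  · obtain ⟨s, -, -, hsup, hlow⟩ := hf.center_slopes hD h hiso hM
    have h1 := hsup i t ⟨ht0, by linarith⟩
    rw [← hi] at h1
    have h2 := hlow i
    have h3 : -(|(D Q : ℝ)| * r + n * (M - f Q)) ≤ s i * t := by
      rcases le_total 0 (s i : ℝ) with h0 | h0
      · have := mul_nonneg h0 ht0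
        linarith
      · nlinarith
    nlinarith

/-- `M - f x` is bounded in terms of `M - f y`, uniformly in `f`. -/
def Dominated (D : Divisor Γ) (P x y : Γ) : Prop :=
  ∃ K : ℝ, 0 ≤ K ∧ ∀ f, Admissible D P f → ∀ M, (∀ x, f x ≤ M) →
    1 + (M - f x) ≤ K * (1 + (M - f y))

theorem Dominated.trans {x y z : Γ} (h : Dominated D P x y) (h' : Dominated D P y z) :
    Dominated D P x z := by
  obtain ⟨K, hK, h⟩ := h
  obtain ⟨K', hK', h'⟩ := h'
  refine ⟨K * K', mul_nonneg hK hK', fun f hf M hM => ?_⟩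
  have h1 := h f hf M hM
  have h2 := mul_le_mul_of_nonneg_left (h' f hf M hM) hK
  linarith

theorem dominated [ConnectedSpace Γ] (hs : ∀ Q : Γ, ∃ n r τ, IsStar Q n r τ)
    (hD : ∀ x, x ≠ P → 0 ≤ D x) (x y : Γ) : Dominated D P x y := by
  refine PreconnectedSpace.induction₂' (Dominated D P) (fun Q => ?_)
    ⟨fun _ _ _ => Dominated.trans⟩ x y
  obtain ⟨V, hV, K, hK, h⟩ := harnack hs hD Q
  filter_upwards [hV] with z hz
  exact ⟨⟨K, hK, fun f hf M hM => (h f hf M hM z hz).1⟩,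
    ⟨K, hK, fun f hf M hM => (h f hf M hM z hz).2⟩⟩

/-- Admissible functions are uniformly bounded. -/
theorem exists_bound [CompactSpace Γ] [ConnectedSpace Γ] (hs : ∀ Q : Γ, ∃ n r τ, IsStar Q n r τ)
    (hD : ∀ x, x ≠ P → 0 ≤ D x) : ∃ K : ℝ, 0 ≤ K ∧ ∀ f, Admissible D P f → ∀ x, f x ≤ K := by
  obtain ⟨K, hK, h⟩ : ∃ K : ℝ, 0 ≤ K ∧ ∀ f, Admissible D P f → ∀ M, (∀ x, f x ≤ M) →
      ∀ z ∈ (univ : Set Γ), 1 + (M - f P) ≤ K * (1 + (M - f z)) := by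
    refine isCompact_univ.induction_on (p := fun S => ∃ K : ℝ, 0 ≤ K ∧ ∀ f, Admissible D P f →
      ∀ M, (∀ x, f x ≤ M) → ∀ z ∈ S, 1 + (M - f P) ≤ K * (1 + (M - f z))) ?_ ?_ ?_ ?_
    · exact ⟨0, le_rfl, by simp⟩
    · rintro S T hST ⟨K, hK, h⟩
      exact ⟨K, hK, fun f hf M hM z hz => h f hf M hM z (hST hz)⟩
    · rintro S T ⟨K, hK, h⟩ ⟨K', hK', h'⟩
      refine ⟨K + K', add_nonneg hK hK', fun f hf M hM z hz => ?_⟩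
      have h0 : 0 ≤ 1 + (M - f z) := by linarith [hM z]
      have h1 := mul_nonneg hK h0
      have h2 := mul_nonneg hK' h0
      rcases hz with hz | hz
      · linarith [h f hf M hM z hz]
      · linarith [h' f hf M hM z hz]
    · intro Q _
      obtain ⟨V, hV, K, hK, h⟩ := harnack hs hD Q
      obtain ⟨K', hK', h'⟩ := dominated hs hD P Q
      refine ⟨V, mem_nhdsWithin_of_mem_nhds hV, K' * K, mul_nonneg hK' hK,
        fun f hf M hM z hz => ?_⟩
      have h1 := h' f hf M hM
      have h2 := mul_le_mul_of_nonneg_left (h f hf M hM z hz).1 hK'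
      linarith
  refine ⟨K, hK, fun f hf x => ?_⟩
  have hcont : Continuous f := hf.choose_spec.1.1.1
  obtain ⟨z, -, hz⟩ := isCompact_univ.exists_isMaxOn ⟨x, mem_univ x⟩ hcont.continuousOn
  have h1 := h f hf (f z) (fun y => hz (mem_univ y)) z (mem_univ z)
  have h2 : f x ≤ f z := hz (mem_univ x)
  rw [hf.choose_spec.2.2.1] at h1
  linarith

/-- On the inner half of a star, admissible functions have support lines whose slopes are
uniformly bounded integers. -/
theorem Admissible.support_lines (hD : ∀ x, x ≠ P → 0 ≤ D x) (h : IsStar Q n r τ)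
    (hiso : ∀ x, x ≠ Q → dist x Q ≤ r → D x = 0) {K : ℝ}
    (hK : ∀ f, Admissible D P f → ∀ x, f x ≤ K) :
    ∃ N : ℕ, ∀ f, Admissible D P f → ∀ i, ∀ t ∈ Icc 0 (r / 2), ∃ a : ℤ, |a| ≤ N ∧
      ∀ u ∈ Icc 0 r, f (τ i t) + a * (u - t) ≤ f (τ i u) := by
  have hr := h.pos
  set B : ℝ := 2 * K / r + (|(D Q : ℝ)| + n * K / r) with hB
  refine ⟨⌈B⌉₊, fun f hf i t ht => ?_⟩
  have h0 : ∀ x, 0 ≤ f x := hf.choose_spec.2.1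
  have hM := hK f hf
  have hK0 : 0 ≤ K := (h0 Q).trans (hM Q)
  obtain ⟨s, hsl, -, hsup, hlow⟩ := hf.center_slopes hD h hiso hM
  have htr : t ∈ Ico 0 r := ⟨ht.1, by linarith [ht.2]⟩
  obtain ⟨a, ha⟩ : ∃ a : ℤ, HasSlopeAlong (fun u => f (τ i u)) (fun u => t + u) a := by
    rcases ht.1.eq_or_lt with rfl | h0t
    · exact ⟨s i, by simp only [zero_add]; exact hsl i⟩
    · obtain ⟨ρ, hρ⟩ := h.interior i ⟨h0t, htr.2⟩
      obtain ⟨s, hs, -⟩ := hf.choose_spec.1.exists_slopes hρ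
      exact ⟨s 0, hs 0⟩
  have hline : ∀ u ∈ Icc 0 r, f (τ i t) + a * (u - t) ≤ f (τ i u) := fun u hu =>
    ConvexOn.support_line (hf.convexOn hD h hiso i) htr ha hu
  refine ⟨a, ?_, hline⟩
  have hup : (a : ℝ) * r ≤ 2 * K := by
    rcases le_total (a : ℝ) 0 with ha0 | ha0
    · have := mul_nonpos_of_nonpos_of_nonneg ha0 hr.le
      linarith
    · have h1 := hline r ⟨hr.le, le_rfl⟩
      have h2 := hM (τ i r)
      have h3 := h0 (τ i t)
      nlinarith [ht.2]
  have hsa : s i ≤ a := by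
    rcases ht.1.eq_or_lt with rfl | h0t
    · have : HasSlopeAlong (fun u => f (τ i u)) (fun u => 0 + u) (s i) := by
        simp only [zero_add]
        exact hsl i
      exact (slope_unique this ha).le
    · have h1 := hline 0 ⟨le_rfl, hr.le⟩
      have h2 := hsup i t ⟨ht.1, htr.2.le⟩
      rw [h.zero] at h1
      have : (s i : ℝ) ≤ a := by nlinarith
      exact_mod_cast this
  have hsa' : (s i : ℝ) * r ≤ a * r := mul_le_mul_of_nonneg_right (by exact_mod_cast hsa) hr.le
  have hn : (n : ℝ) * (K - f Q) ≤ n * K :=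
    mul_le_mul_of_nonneg_left (by linarith [h0 Q]) n.cast_nonneg
  have hBr : B * r = 2 * K + (|(D Q : ℝ)| * r + n * K) := by
    rw [hB]
    field_simp
  have hd0 := mul_nonneg (abs_nonneg (D Q : ℝ)) hr.le
  have hnK := mul_nonneg (n.cast_nonneg (α := ℝ)) hK0
  have habs : |(a : ℝ)| ≤ B := by
    rw [abs_le]
    constructor
    · refine le_of_mul_le_mul_right ?_ hr
      linarith [hlow i]
    · refine le_of_mul_le_mul_right ?_ hr
      linarith
  have := habs.trans (Nat.le_ceil B)
  exact_mod_cast this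

theorem admissible_zero (hs : ∀ Q : Γ, ∃ n r τ, IsStar Q n r τ) (hD : ∀ x, x ≠ P → 0 ≤ D x) :
    Admissible D P 0 :=
  ⟨0, hasDiv_zero hs, by simp, rfl, by simpa using hD⟩

/-- There is a largest admissible function. -/
theorem exists_max_admissible [CompactSpace Γ] [ConnectedSpace Γ]
    (hs : ∀ Q : Γ, ∃ n r τ, IsStar Q n r τ) (hD : ∀ x, x ≠ P → 0 ≤ D x) :
    ∃ F, Admissible D P F ∧ ∀ f, Admissible D P f → ∀ x, f x ≤ F x := by
  obtain ⟨K, hK0, hK⟩ := exists_bound hs hD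
  have hz := admissible_zero hs hD
  set F : Γ → ℝ := fun x => sSup ((fun f : Γ → ℝ => f x) '' {f | Admissible D P f}) with hF
  have hlub : ∀ x, IsLUB ((fun f : Γ → ℝ => f x) '' {f | Admissible D P f}) (F x) := by
    intro x
    refine isLUB_csSup ⟨_, 0, hz, rfl⟩ ⟨K, ?_⟩
    rintro _ ⟨f, hf, rfl⟩
    exact hK f hf x
  have hle : ∀ f, Admissible D P f → ∀ x, f x ≤ F x := fun f hf x =>
    (hlub x).1 ⟨f, hf, rfl⟩
  have hstar : ∀ Q, ∃ m, StarOrder F Q m ∧ (Q ≠ P → -D Q ≤ m) := by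
    intro Q
    obtain ⟨n, r, τ, h, hiso⟩ := exists_isolating_star hs D Q
    obtain ⟨N, hN⟩ := Admissible.support_lines hD h hiso hK
    have hslope : ∀ i, ∃ s, HasSlopeAlong F (τ i) s := by
      intro i
      refine exists_slope_of_isLUB (A := (fun f t => f (τ i t)) '' {f | Admissible D P f})
        (F := fun t => F (τ i t)) (half_pos h.pos) (N := N) ⟨_, 0, hz, rfl⟩ ?_ ?_ ?_
      · intro t _
        rw [image_image]
        exact hlub (τ i t)
      · rintro _ ⟨f, hf, rfl⟩ t _
        exact hf.choose_spec.2.1 _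
      · rintro _ ⟨f, hf, rfl⟩ t ht
        obtain ⟨a, ha, hline⟩ := hN f hf i t ht
        exact ⟨a, ha, fun u hu => hline u ⟨hu.1, by linarith [hu.2, h.pos]⟩⟩
    choose s hsl using hslope
    refine ⟨∑ i, s i, ⟨n, r, τ, s, h, hsl, rfl⟩, fun hQ => ?_⟩
    obtain ⟨ε, hε, hlin⟩ := h.slope_bounds hsl
    obtain ⟨_, ⟨f, hf, rfl⟩, hfQ⟩ := (lt_isLUB_iff (hlub Q)).1 (sub_lt_self (F Q) hε.1)
    obtain ⟨s', -, hsum, hsup, -⟩ := hf.center_slopes hD h hiso (hK f hf)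
    refine (hsum hQ).trans (Finset.sum_le_sum fun i _ => ?_)
    have h1 := hsup i ε ⟨hε.1.le, hε.2⟩
    have h2 := hle f hf (τ i ε)
    rw [hlin i ε ⟨hε.1.le, le_rfl⟩] at h2
    have h3 : (s' i : ℝ) < s i + 1 := by
      have := hε.1
      by_contra! h4
      have := mul_le_mul_of_nonneg_right h4 hε.1.le
      simp only at hfQ
      linarith
    have h4 : s' i < s i + 1 := by exact_mod_cast h3
    omega
  obtain ⟨E, hE⟩ : ∃ E : Divisor Γ, HasDiv F E :=
    exists_hasDiv fun Q => (hstar Q).imp fun m hm => hm.1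
  refine ⟨F, ⟨E, hE, fun x => hle 0 hz x, ?_, fun x hx => ?_⟩, hle⟩
  · refine le_antisymm ((hlub P).2 ?_) (hle 0 hz P)
    rintro _ ⟨f, hf, rfl⟩
    exact hf.choose_spec.2.2.1.le
  · obtain ⟨m, hm, hxm⟩ := hstar x
    have := hxm hx
    rw [StarOrder.eq_of_hasDiv hm hE]
    linarith

end Perron

section Firing

variable {Γ : Type*} [MetricSpace Γ] {P Q : Γ} {n : ℕ} {r : ℝ} {τ : Fin n → ℝ → Γ} {Y : Set Γ}

theorem IsStar.isPreconnected_ball (h : IsStar Q n r τ) : IsPreconnected (Metric.ball Q r) := by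
  refine isPreconnected_of_forall Q fun x hx => ?_
  obtain ⟨i, hi⟩ := h.cover x hx
  refine ⟨τ i '' Ico 0 r, ?_, ⟨0, ⟨le_rfl, h.pos⟩, h.zero i⟩, ⟨_, ⟨dist_nonneg, hx⟩, hi.symm⟩,
    isPreconnected_Ico.image _ ((h.continuousOn i).mono Ico_subset_Icc_self)⟩
  rintro _ ⟨t, ht, rfl⟩
  rw [Metric.mem_ball, h.dist_center i ⟨ht.1, ht.2.le⟩]
  exact ht.2

theorem locallyConnectedSpace (hs : ∀ Q : Γ, ∃ n r τ, IsStar Q n r τ) :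
    LocallyConnectedSpace Γ := by
  refine locallyConnectedSpace_of_connected_bases (fun Q ε => Metric.ball Q ε)
    (fun Q ε => ∃ n τ, IsStar Q n ε τ) (fun Q => ⟨fun U => ⟨fun hU => ?_, ?_⟩⟩) ?_
  · obtain ⟨n, r, τ, h⟩ := hs Q
    obtain ⟨ε, hε, hball⟩ := Metric.mem_nhds_iff.1 hU
    exact ⟨min ε r, ⟨n, τ, h.mono (lt_min hε h.pos) (min_le_right _ _)⟩,
      (Metric.ball_subset_ball (min_le_left _ _)).trans hball⟩
  · rintro ⟨ε, ⟨n, τ, h⟩, hball⟩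
    exact Filter.mem_of_superset (Metric.ball_mem_nhds _ h.pos) hball
  · rintro Q ε ⟨n, τ, h⟩
    exact h.isPreconnected_ball

/-- The rays of the star lie, apart from the centre, either in `Y` or in its complement. -/
def IsStar.Adapted (r : ℝ) (τ : Fin n → ℝ → Γ) (Y : Set Γ) : Prop :=
  ∀ i, (∀ t ∈ Ioo 0 r, τ i t ∈ Y) ∨ ∀ t ∈ Ioo 0 r, τ i t ∉ Y

/-- If `Y` has connected complement, then its trace on a ray is order convex. -/
theorem IsStar.mem_of_mem_of_mem (h : IsStar Q n r τ) (hY : IsPreconnected Yᶜ) (hP : P ∉ Y)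
    (hPQ : dist P Q ∉ Ioo 0 r) (i : Fin n) {a b c : ℝ} (ha : 0 < a) (hab : a < b) (hbc : b < c)
    (hc : c < r) (haY : τ i a ∈ Y) (hcY : τ i c ∈ Y) : τ i b ∈ Y := by
  by_contra hb
  have hcl : IsClosed (τ i '' Icc a c) :=
    (isCompact_Icc.image_of_continuousOn ((h.continuousOn i).mono
      (Icc_subset_Icc ha.le hc.le))).isClosed
  have hPray : P ∉ τ i '' Icc a c := by
    rintro ⟨t, ht, rfl⟩
    rw [h.dist_center i ⟨by linarith [ht.1], by linarith [ht.2]⟩] at hPQ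
    exact hPQ ⟨by linarith [ht.1], by linarith [ht.2]⟩
  have hcover : Yᶜ ⊆ τ i '' Ioo a c ∪ (τ i '' Icc a c)ᶜ := by
    intro x hx
    by_cases hxr : x ∈ τ i '' Icc a c
    · obtain ⟨t, ht, rfl⟩ := hxr
      refine Or.inl ⟨t, ⟨lt_of_le_of_ne ht.1 ?_, lt_of_le_of_ne ht.2 ?_⟩, rfl⟩
      · rintro rfl
        exact hx haY
      · rintro rfl
        exact hx hcY
    · exact Or.inr hxr
  obtain ⟨x, -, ⟨t, ht, rfl⟩, hx⟩ := hY _ _ (h.isOpen_ray i ha.le hc.le) hcl.isOpen_compl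
    hcover ⟨_, hb, b, ⟨hab, hbc⟩, rfl⟩ ⟨P, hP, hPray⟩
  exact hx ⟨t, ⟨ht.1.le, ht.2.le⟩, rfl⟩

theorem exists_adapted_star (hs : ∀ Q : Γ, ∃ n r τ, IsStar Q n r τ) (hY : IsPreconnected Yᶜ)
    (hP : P ∉ Y) (Q : Γ) :
    ∃ (n : ℕ) (r : ℝ) (τ : Fin n → ℝ → Γ), IsStar Q n r τ ∧ IsStar.Adapted r τ Y := by
  obtain ⟨n, r, τ, h, hPQ⟩ : ∃ (n : ℕ) (r : ℝ) (τ : Fin n → ℝ → Γ),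
      IsStar Q n r τ ∧ dist P Q ∉ Ioo 0 r := by
    obtain ⟨n, r, τ, h⟩ := hs Q
    rcases (dist_nonneg (x := P) (y := Q)).eq_or_lt with h0 | h0
    · exact ⟨n, r, τ, h, fun h' => h'.1.ne h0⟩
    · exact ⟨n, min r (dist P Q), τ, h.mono (lt_min h.pos h0) (min_le_left _ _),
        fun h' => (h'.2.trans_le (min_le_right _ _)).false⟩
  have key : ∀ i, ∃ ρ > 0, (∀ t ∈ Ioo 0 ρ, τ i t ∈ Y) ∨ ∀ t ∈ Ioo 0 ρ, τ i t ∉ Y := by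
    intro i
    by_cases hout : ∃ ρ > 0, ∀ t ∈ Ioo 0 ρ, τ i t ∉ Y
    · obtain ⟨ρ, hρ, hout⟩ := hout
      exact ⟨ρ, hρ, Or.inr hout⟩
    push Not at hout
    obtain ⟨c, hc, hcY⟩ := hout r h.pos
    refine ⟨c, hc.1, Or.inl fun b hb => ?_⟩
    obtain ⟨a, ha, haY⟩ := hout b hb.1
    exact h.mem_of_mem_of_mem hY hP hPQ i ha.1 ha.2 hb.2 hc.2 haY hcY
  choose ρ hρ hρY using key
  have hev : ∀ᶠ t in 𝓝[>] (0 : ℝ), 0 < t ∧ t ≤ r ∧ ∀ i, t ≤ ρ i :=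
    eventually_mem_nhdsWithin.and
      (Eventually.and (nhdsWithin_le_nhds (Iic_mem_nhds h.pos))
        (eventually_all.2 fun i => nhdsWithin_le_nhds (Iic_mem_nhds (hρ i))))
  obtain ⟨t, ht, htr, htρ⟩ := hev.exists
  refine ⟨n, t, τ, h.mono ht htr, fun i => (hρY i).imp ?_ ?_⟩
  · exact fun H u hu => H u ⟨hu.1, hu.2.trans_le (htρ i)⟩
  · exact fun H u hu => H u ⟨hu.1, hu.2.trans_le (htρ i)⟩

theorem IsStar.eq_center_of_mem_frontier (h : IsStar Q n r τ) (hA : IsStar.Adapted r τ Y) {x : Γ}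
    (hx : x ∈ frontier Y) (hd : dist x Q < r) : x = Q := by
  by_contra hne
  obtain ⟨i, hi⟩ := h.cover x hd
  have hnhds : τ i '' Ioo 0 r ∈ 𝓝 x := by
    rw [hi]
    exact h.ray_mem_nhds i le_rfl le_rfl ⟨dist_pos.2 hne, hd⟩
  rcases hA i with H | H
  · refine hx.2 (mem_interior_iff_mem_nhds.2 (mem_of_superset hnhds ?_))
    rintro _ ⟨t, ht, rfl⟩
    exact H t ht
  · obtain ⟨_, ⟨t, ht, rfl⟩, hy⟩ := mem_closure_iff_nhds.1 hx.1 _ hnhds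
    exact H t ht hy

/-- Firing the chips on a closed set `Y` all of whose points have adapted stars. -/
theorem exists_firing [CompactSpace Γ] [ConnectedSpace Γ] (hYc : IsClosed Y) (hne : Y.Nonempty)
    (hP : P ∉ Y) (hA : ∀ Q, ∃ (n : ℕ) (r : ℝ) (τ : Fin n → ℝ → Γ),
      IsStar Q n r τ ∧ IsStar.Adapted r τ Y) :
    ∃ (g : Γ → ℝ) (E : Divisor Γ), HasDiv g E ∧ (∀ x, 0 ≤ g x) ∧ g P = 0 ∧ (∀ x ∈ Y, 0 < g x) ∧
      ∀ x, 0 ≤ E x ∨ x ∈ frontier Y ∧ ∃ (k : ℕ) (υ : Fin k → ℝ → Γ), (∀ i, IsArcAt x (υ i)) ∧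
        (∀ i, ArcLeaves Y (υ i)) ∧ Pairwise (fun i j => ¬ ArcEquiv (υ i) (υ j)) ∧ E x = -k := by
  classical
  choose n r τ hS hA using hA
  set B := frontier Y with hB
  have hBfin : B.Finite := finite_of_nhds fun Q =>
    ⟨_, Metric.ball_mem_nhds Q (hS Q).pos, fun x hx =>
      (hS Q).eq_center_of_mem_frontier (hA Q) hx.2 hx.1⟩
  have hBne : B.Nonempty := nonempty_frontier_iff.2 ⟨hne, fun h => hP (h ▸ mem_univ P)⟩
  have hBY : B ⊆ Y := hYc.frontier_subset
  have hPB : 0 < Metric.infDist P B :=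
    (isClosed_frontier.notMem_iff_infDist_pos hBne).1 fun h => hP (hBY h)
  obtain ⟨ε, hε, hεP, hεr⟩ :
      ∃ ε : ℝ, 0 < ε ∧ ε ≤ Metric.infDist P B ∧ ∀ Q ∈ B, ε < r Q / 2 := by
    have hev : ∀ᶠ ε in 𝓝[>] (0 : ℝ), 0 < ε ∧ ε ≤ Metric.infDist P B ∧ ∀ Q ∈ B, ε < r Q / 2 :=
      eventually_mem_nhdsWithin.and
        (Eventually.and (nhdsWithin_le_nhds (Iic_mem_nhds hPB))
          ((eventually_all_finite hBfin).2 fun Q _ =>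
            nhdsWithin_le_nhds (Iio_mem_nhds (half_pos (hS Q).pos))))
    exact hev.exists
  set g : Γ → ℝ := fun x => if x ∈ Y then ε else max (ε - Metric.infDist x B) 0 with hg
  have hgY : ∀ x ∈ Y, g x = ε := fun x hx => if_pos hx
  have hgout : ∀ x ∉ Y, g x = max (ε - Metric.infDist x B) 0 := fun x hx => if_neg hx
  have hout : ∀ Q ∈ B, ∀ i, ∀ t ∈ Ioo 0 (r Q / 2), τ Q i t ∉ Y → g (τ Q i t) = max (ε - t) 0 := by
    intro Q hQ i t ht hY
    have hr := (hS Q).pos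
    have hd := (hS Q).dist_center i (t := t) ⟨ht.1.le, by linarith [ht.2]⟩
    have : Metric.infDist (τ Q i t) B = t := by
      refine le_antisymm ((Metric.infDist_le_dist_of_mem hQ).trans_eq hd) ?_
      refine (Metric.le_infDist hBne).2 fun y hy => ?_
      by_contra! hlt
      have hyQ : y = Q := (hS Q).eq_center_of_mem_frontier (hA Q) hy (by
        have := dist_triangle_left y Q (τ Q i t)
        linarith [ht.2])
      rw [hyQ, hd] at hlt
      exact hlt.false
    rw [hgout _ hY, this]
  have hstar : ∀ x, ∃ m, StarOrder g x m ∧ (0 ≤ m ∨ x ∈ B ∧ ∃ (k : ℕ) (υ : Fin k → ℝ → Γ),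
      (∀ i, IsArcAt x (υ i)) ∧ (∀ i, ArcLeaves Y (υ i)) ∧
        Pairwise (fun i j => ¬ ArcEquiv (υ i) (υ j)) ∧ m = -k) := by
    intro x
    by_cases hxB : x ∈ B
    · set O : Finset (Fin (n x)) := {i | ∀ t ∈ Ioo 0 (r x), τ x i t ∉ Y} with hO
      have hsum : -(O.card : ℤ) = ∑ i, if i ∈ O then -1 else 0 := by
        rw [Finset.sum_ite_mem, Finset.univ_inter, Finset.sum_const, smul_neg, nsmul_one]
      refine ⟨-(O.card : ℤ), ⟨n x, r x, τ x, _, hS x, fun i => ?_, hsum⟩, Or.inr ⟨hxB, O.card,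
        fun j => τ x (O.orderEmbOfFin rfl j), fun j => (hS x).isArcAt _, fun j => ?_, ?_, rfl⟩⟩
      · refine ⟨ε, hε, fun t ht => ?_⟩
        rw [(hS x).zero i, hgY x (hBY hxB)]
        rcases ht.1.eq_or_lt with rfl | ht0
        · rw [(hS x).zero i, hgY x (hBY hxB)]
          simp
        have hr := hεr x hxB
        have htr : t ∈ Ioo 0 (r x) := ⟨ht0, by linarith [ht.2]⟩
        by_cases hi : i ∈ O
        · rw [hout x hxB i t ⟨ht0, by linarith [ht.2]⟩ ((Finset.mem_filter.1 hi).2 t htr),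
            max_eq_left (by linarith [ht.2]), if_pos hi]
          push_cast
          ring
        · have hin : ∀ t ∈ Ioo 0 (r x), τ x i t ∈ Y :=
            (hA x i).resolve_right fun h => hi (Finset.mem_filter.2 ⟨Finset.mem_univ _, h⟩)
          rw [hgY _ (hin t htr), if_neg hi]
          simp
      · have := (Finset.mem_filter.1 (O.orderEmbOfFin_mem rfl j)).2
        have hr := (hS x).pos
        exact ⟨r x / 2, half_pos hr, fun t ht => this t ⟨ht.1, by linarith [ht.2]⟩⟩
      · intro i j hij
        exact (hS x).isArcFrame.2.1 fun h => hij ((O.orderEmbOfFin rfl).injective h)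
    by_cases hxY : x ∈ Y
    · refine ⟨0, (hS x).starOrder_const ε ?_, Or.inl le_rfl⟩
      have hint : x ∈ interior Y := by
        by_contra h
        exact hxB ⟨subset_closure hxY, h⟩
      filter_upwards [mem_interior_iff_mem_nhds.1 hint] with y hy using hgY y hy
    obtain ⟨Q, hQ, hQd⟩ := hBfin.isCompact.exists_infDist_eq_dist hBne x
    rcases lt_or_ge ε (Metric.infDist x B) with hlt | hle
    · refine ⟨0, (hS x).starOrder_const 0 ?_, Or.inl le_rfl⟩
      filter_upwards [hYc.isOpen_compl.mem_nhds hxY,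
        (Metric.continuous_infDist_pt B).continuousAt.eventually (lt_mem_nhds hlt)] with y hy hy'
      rw [hgout y hy, max_eq_right (by linarith)]
    · have hr := hεr Q hQ
      have hr0 := (hS Q).pos
      rw [hQd] at hle
      have hd : dist x Q ∈ Ioo 0 (r Q / 2) :=
        ⟨dist_pos.2 fun h => hxB (h ▸ hQ), hle.trans_lt hr⟩
      obtain ⟨i, hi⟩ := (hS Q).cover x (by linarith [hd.2])
      have hiout : ∀ t ∈ Ioo 0 (r Q), τ Q i t ∉ Y := (hA Q i).resolve_left fun h =>
        hxY (hi ▸ h _ ⟨hd.1, by linarith [hd.2]⟩)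
      obtain ⟨a, b, ha, hb, hab, -⟩ := cone_slopes ε (dist x Q)
      refine ⟨a + b, ?_, Or.inl hab⟩
      have := ((hS Q).mono (half_pos hr0) (by linarith)).starOrder_of_profile (f := g) i hd
        (fun u hu => hout Q hQ i u hu (hiout u ⟨hu.1, by linarith [hu.2]⟩)) ha hb
      rwa [← hi] at this
  obtain ⟨E, hE⟩ : ∃ E : Divisor Γ, HasDiv g E :=
    exists_hasDiv fun x => (hstar x).imp fun m hm => hm.1
  refine ⟨g, E, hE, fun x => ?_, ?_, fun x hx => hgY x hx ▸ hε, fun x => ?_⟩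
  · by_cases hx : x ∈ Y
    · exact hgY x hx ▸ hε.le
    · exact hgout x hx ▸ le_max_right _ _
  · rw [hgout P hP, max_eq_right (by linarith)]
  · obtain ⟨m, hm, h⟩ := hstar x
    rw [StarOrder.eq_of_hasDiv hm hE]
    exact h

theorem frontier_compl_connectedComponentIn_subset [LocallyConnectedSpace Γ] {X : Set Γ}
    (hX : IsClosed X) : frontier (connectedComponentIn Xᶜ P)ᶜ ⊆ frontier X := by
  set W := connectedComponentIn Xᶜ P with hW
  have hWo : IsOpen W := hX.isOpen_compl.connectedComponentIn
  rw [frontier_compl]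
  intro Q hQ
  have hQW : Q ∉ W := by
    have := hQ.2
    rwa [hWo.interior_eq] at this
  have hQX : Q ∈ X := by
    by_contra hQX
    have hV : IsOpen (connectedComponentIn Xᶜ Q) := hX.isOpen_compl.connectedComponentIn
    obtain ⟨z, hzQ, hzW⟩ := mem_closure_iff.1 hQ.1 _ hV (mem_connectedComponentIn hQX)
    refine hQW ?_
    rw [hW, connectedComponentIn_eq hzW, ← connectedComponentIn_eq hzQ]
    exact mem_connectedComponentIn hQX
  refine ⟨subset_closure hQX, fun hint => ?_⟩
  obtain ⟨z, hz, hzW⟩ := mem_closure_iff.1 hQ.1 _ isOpen_interior hint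
  exact connectedComponentIn_subset _ _ hzW (interior_subset hz)

theorem isReducedDivisor_of_isMax [CompactSpace Γ] [ConnectedSpace Γ]
    (hs : ∀ Q : Γ, ∃ n r τ, IsStar Q n r τ) {D E : Divisor Γ} {F : Γ → ℝ} (hE : HasDiv F E)
    (hF : Admissible D P F) (hmax : ∀ f, Admissible D P f → ∀ x, f x ≤ F x) :
    IsReducedDivisor Γ (D + E) P := by
  obtain ⟨E', hE', hF0, hFP, hDE⟩ := hF
  obtain rfl : E' = E := Finsupp.ext fun x => HasOrderAt.unique (hE'.2 x) (hE.2 x)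
  refine ⟨hDE, fun X hX hXne hPX => ?_⟩
  by_contra! hsat
  have := locallyConnectedSpace hs
  set Y := (connectedComponentIn Xᶜ P)ᶜ with hY
  have hXY : X ⊆ Y := fun x hx hxW => connectedComponentIn_subset _ _ hxW hx
  have hPY : P ∉ Y := fun h => h (mem_connectedComponentIn hPX)
  have hYc : IsClosed Y := hX.isOpen_compl.connectedComponentIn.isClosed_compl
  have hYpre : IsPreconnected Yᶜ := by
    rw [hY, compl_compl]
    exact isPreconnected_connectedComponentIn
  obtain ⟨g, E, hg, hg0, hgP, hgY, hgE⟩ := exists_firing hYc (hXne.mono hXY) hPY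
    (exists_adapted_star hs hYpre hPY)
  have hadm : Admissible D P (F + g) := by
    refine ⟨E' + E, hE.add hg, fun x => add_nonneg (hF0 x) (hg0 x), by simp [hFP, hgP],
      fun x hx => ?_⟩
    have h1 := hDE x hx
    rw [Finsupp.add_apply]
    rcases hgE x with h | ⟨hxB, k, υ, hυ, hl, hp, hk⟩
    · omega
    · by_contra! hlt
      refine hsat x ⟨frontier_compl_connectedComponentIn_subset hX hxB, k, υ, hυ,
        fun i => ?_, hp, ?_⟩
      · obtain ⟨δ, hδ, h⟩ := hl i
        exact ⟨δ, hδ, fun t ht htX => h t ht (hXY htX)⟩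
      · rw [Finsupp.add_apply]
        omega
  obtain ⟨x, hx⟩ := hXne
  have h1 := hmax _ hadm x
  have h2 := hgY x (hXY hx)
  rw [Pi.add_apply] at h1
  linarith

end Firing

end MetricGraph

/-- Existence and uniqueness of the `P`-reduced divisor linearly
equivalent to a given divisor `D` on a metric graph. -/
theorem statement2 (Γ : Type) [MetricSpace Γ] (hΓ : IsMetricGraph Γ)
    (D : Divisor Γ) (P : Γ) :
    ∃! DP : Divisor Γ, IsReducedDivisor Γ DP P ∧ LinEquiv Γ D DP := by
  obtain ⟨hcompact, hconnected, hstar⟩ := hΓ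
  have hs : ∀ Q : Γ, ∃ n r τ, MetricGraph.IsStar Q n r τ := fun Q =>
    have ⟨n, hn, h⟩ := hstar Q
    ⟨n, MetricGraph.exists_isStar_of_hasStarNbhd hn h⟩
  obtain ⟨f, E, hf, hD⟩ := MetricGraph.exists_effective_away hs P D
  obtain ⟨F, hF, hmax⟩ := MetricGraph.exists_max_admissible (D := D + E) hs hD
  obtain ⟨E', hE', -⟩ := id hF
  have hequiv : LinEquiv Γ D (D + E + E') := by
    refine MetricGraph.linEquiv_iff.2 ⟨f + F, ?_⟩
    rw [add_assoc, add_sub_cancel_left]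
    exact hf.add hE'
  have hred := MetricGraph.isReducedDivisor_of_isMax hs hE' hF hmax
  exact ⟨_, ⟨hred, hequiv⟩, fun D' h =>
    MetricGraph.IsReducedDivisor.unique h.1 hred h.2 hequiv⟩
end

section
/- Let D be a divisor on a metric graph Γ that is linearly equivalent to an effective divisor, let P ∈ Γ, and let D_P be the P-reduced divisor linearly equivalent to D. Then D_P(P) ≥ D'(P) for every effective divisor D' linearly equivalent to D; that is, D_P(P) is the maximal coefficient of P among all effective divisors in the linear equivalence class of D. -/
theorem ArcEquiv.symm {Γ : Type*} {τ σ : ℝ → Γ} (h : ArcEquiv τ σ) : ArcEquiv σ τ := by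
  obtain ⟨ε, hε, h⟩ := h
  exact ⟨ε, hε, fun t ht => (h t ht).symm⟩

theorem ArcEquiv.trans {Γ : Type*} {τ σ ρ : ℝ → Γ} (h : ArcEquiv τ σ) (h' : ArcEquiv σ ρ) :
    ArcEquiv τ ρ := by
  obtain ⟨ε, hε, h⟩ := h
  obtain ⟨δ, hδ, h'⟩ := h'
  exact ⟨min ε δ, lt_min hε hδ, fun t ht =>
    (h t ⟨ht.1, ht.2.trans (min_le_left _ _)⟩).trans
      (h' t ⟨ht.1, ht.2.trans (min_le_right _ _)⟩)⟩

theorem HasSlopeAlong.congr {Γ : Type*} {f : Γ → ℝ} {τ σ : ℝ → Γ} {s : ℤ}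
    (hf : HasSlopeAlong f τ s) (h : ArcEquiv τ σ) : HasSlopeAlong f σ s := by
  obtain ⟨ε, hε, h⟩ := h
  obtain ⟨δ, hδ, hf⟩ := hf
  refine ⟨min ε δ, lt_min hε hδ, fun t ht => ?_⟩
  rw [← h t ⟨ht.1, ht.2.trans (min_le_left _ _)⟩, ← h 0 ⟨le_rfl, hε.le⟩]
  exact hf t ⟨ht.1, ht.2.trans (min_le_right _ _)⟩

theorem HasSlopeAlong.sub {Γ : Type*} {f g : Γ → ℝ} {τ : ℝ → Γ} {s s' : ℤ}
    (hf : HasSlopeAlong f τ s) (hg : HasSlopeAlong g τ s') :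
    HasSlopeAlong (fun x => f x - g x) τ (s - s') := by
  obtain ⟨ε, hε, hf⟩ := hf
  obtain ⟨δ, hδ, hg⟩ := hg
  refine ⟨min ε δ, lt_min hε hδ, fun t ht => ?_⟩
  simp only [hf t ⟨ht.1, ht.2.trans (min_le_left _ _)⟩,
    hg t ⟨ht.1, ht.2.trans (min_le_right _ _)⟩]
  push_cast
  ring

theorem ArcLeaves.congr {Γ : Type*} {X : Set Γ} {τ σ : ℝ → Γ}
    (hX : ArcLeaves X τ) (h : ArcEquiv τ σ) : ArcLeaves X σ := by
  obtain ⟨ε, hε, h⟩ := h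
  obtain ⟨δ, hδ, hX⟩ := hX
  refine ⟨min ε δ, lt_min hε hδ, fun t ht => ?_⟩
  rw [← h t ⟨ht.1.le, ht.2.trans (min_le_left _ _)⟩]
  exact hX t ⟨ht.1, ht.2.trans (min_le_right _ _)⟩

/-- Slopes at a maximum point are nonpositive. -/
theorem HasSlopeAlong.nonpos_of_isMax {Γ : Type*} {g : Γ → ℝ} {τ : ℝ → Γ} {s : ℤ}
    (hg : HasSlopeAlong g τ s) (hmax : ∀ x, g x ≤ g (τ 0)) : s ≤ 0 := by
  obtain ⟨ε, hε, hg⟩ := hg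
  have h := hg ε ⟨hε.le, le_rfl⟩
  by_contra! hs
  have hs' : (0 : ℝ) < s := by exact_mod_cast hs
  linarith [hmax (τ ε), mul_pos hs' hε]

/-- Slopes at a maximum point are negative along arcs leaving the locus of maximum. -/
theorem HasSlopeAlong.le_neg_one_of_arcLeaves {Γ : Type*} {g : Γ → ℝ} {τ : ℝ → Γ} {s : ℤ}
    (hg : HasSlopeAlong g τ s) (hmax : ∀ x, g x ≤ g (τ 0))
    (hl : ArcLeaves {x | ∀ y, g y ≤ g x} τ) : s ≤ -1 := by
  have hs := hg.nonpos_of_isMax hmax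
  suffices s ≠ 0 by lia
  rintro rfl
  obtain ⟨ε, hε, hg⟩ := hg
  obtain ⟨δ, hδ, hl⟩ := hl
  have hm : 0 < min ε δ := lt_min hε hδ
  refine hl (min ε δ) ⟨hm, min_le_right _ _⟩ fun y => ?_
  rw [hg (min ε δ) ⟨hm.le, min_le_left _ _⟩]
  simpa using hmax y

/-- The order of a function may be computed from any system of representatives of the
tangent directions. -/
theorem HasOrderAt.exists_slopes {Γ : Type*} [MetricSpace Γ] {f : Γ → ℝ} {P : Γ} {m : ℤ}
    (h : HasOrderAt Γ f P m) {n : ℕ} {τ : Fin n → ℝ → Γ} (harc : ∀ i, IsArcAt P (τ i))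
    (hpair : Pairwise fun i j => ¬ ArcEquiv (τ i) (τ j))
    (hall : ∀ σ : ℝ → Γ, IsArcAt P σ → ∃ i, ArcEquiv σ (τ i)) :
    ∃ s : Fin n → ℤ, (∀ i, HasSlopeAlong f (τ i) (s i)) ∧ m = ∑ i, s i := by
  obtain ⟨k, σ, s, hσarc, hσpair, hσall, hs, rfl⟩ := h
  choose e he using fun i => hσall (τ i) (harc i)
  have hbij : Function.Bijective e := by
    constructor
    · intro i j hij
      by_contra hne
      exact hpair hne ((he i).trans (hij ▸ (he j).symm))
    · intro j
      obtain ⟨i, hi⟩ := hall (σ j) (hσarc j)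
      refine ⟨i, ?_⟩
      by_contra hne
      exact hσpair hne ((he i).symm.trans hi.symm)
  exact ⟨fun i => s (e i), fun i => (hs (e i)).congr (he i).symm,
    (hbij.sum_comp s).symm⟩

theorem HasOrderAt.sub {Γ : Type*} [MetricSpace Γ] {f g : Γ → ℝ} {P : Γ} {m m' : ℤ}
    (hf : HasOrderAt Γ f P m) (hg : HasOrderAt Γ g P m') :
    HasOrderAt Γ (fun x => f x - g x) P (m - m') := by
  obtain ⟨n, τ, s, harc, hpair, hall, hs, rfl⟩ := hf
  obtain ⟨s', hs', rfl⟩ := hg.exists_slopes harc hpair hall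
  exact ⟨n, τ, fun i => s i - s' i, harc, hpair, hall, fun i => (hs i).sub (hs' i),
    (Finset.sum_sub_distrib s s').symm⟩

/-- At a maximum point the order is at most minus the number of tangent directions leaving
the locus of maximum. -/
theorem HasOrderAt.le_neg_of_arcLeaves {Γ : Type*} [MetricSpace Γ] {g : Γ → ℝ} {Q : Γ} {m : ℤ}
    (h : HasOrderAt Γ g Q m) (hmax : ∀ x, g x ≤ g Q) {k : ℕ} {σ : Fin k → ℝ → Γ}
    (harc : ∀ j, IsArcAt Q (σ j)) (hl : ∀ j, ArcLeaves {x | ∀ y, g y ≤ g x} (σ j))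
    (hpair : Pairwise fun i j => ¬ ArcEquiv (σ i) (σ j)) : m ≤ -(k : ℤ) := by
  obtain ⟨n, τ, s, hτarc, -, hall, hs, rfl⟩ := h
  choose e he using fun j => hall (σ j) (harc j)
  have hinj : Function.Injective e := by
    intro i j hij
    by_contra hne
    exact hpair hne ((he i).trans (hij ▸ (he j).symm))
  have hmax' : ∀ i x, g x ≤ g (τ i 0) := fun i => by rwa [(hτarc i).1]
  calc ∑ i, s i ≤ ∑ i ∈ Finset.univ.map ⟨e, hinj⟩, s i :=
        by
        rw [← Finset.sum_add_sum_compl (Finset.univ.map ⟨e, hinj⟩) s]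
        exact add_le_of_nonpos_right <| Finset.sum_nonpos fun i _ =>
          (hs i).nonpos_of_isMax (hmax' i)
    _ = ∑ j, s (e j) := Finset.sum_map _ _ _
    _ ≤ ∑ _j : Fin k, (-1 : ℤ) := Finset.sum_le_sum fun j _ =>
        (hs (e j)).le_neg_one_of_arcLeaves (hmax' _) ((hl j).congr (he j))
    _ = -(k : ℤ) := by simp

/-- The `P`-reduced divisor linearly equivalent to `D` has maximal
coefficient at `P` among all effective divisors linearly equivalent to `D`. -/
theorem statement3 (Γ : Type) [MetricSpace Γ] (hΓ : IsMetricGraph Γ)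
    (D : Divisor Γ) (hD : EquivEffective Γ D) (P : Γ)
    (DP : Divisor Γ) (hred : IsReducedDivisor Γ DP P) (hlin : LinEquiv Γ D DP) :
    ∀ D' : Divisor Γ, Effective D' → LinEquiv Γ D D' → D' P ≤ DP P := by
  rintro D' hD' ⟨f', hf', hord'⟩
  obtain ⟨f, hf, hord⟩ := hlin
  have : CompactSpace Γ := hΓ.1
  set g : Γ → ℝ := fun x => f' x - f x
  have hgc : Continuous g := hf'.1.sub hf.1
  have hgord : ∀ Q, HasOrderAt Γ g Q (D' Q - DP Q) := fun Q => by
    simpa using (hord' Q).sub (hord Q)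
  have hclosed : IsClosed {x | ∀ y, g y ≤ g x} := by
    simp only [Set.ofPred_forall]
    exact isClosed_iInter fun y => isClosed_le continuous_const hgc
  by_cases hP : P ∈ {x | ∀ y, g y ≤ g x}
  · have h := (hgord P).le_neg_of_arcLeaves hP (k := 0) (σ := Fin.elim0)
      (fun j => j.elim0) (fun j => j.elim0) (fun j => j.elim0)
    simpa using h
  · obtain ⟨x, -, hx⟩ := isCompact_univ.exists_isMaxOn ⟨P, Set.mem_univ P⟩ hgc.continuousOn
    obtain ⟨Q, hQ, k, σ, harc, hl, hpair, hlt⟩ :=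
      hred.2 _ hclosed ⟨x, fun y => hx (Set.mem_univ y)⟩ hP
    have h := (hgord Q).le_neg_of_arcLeaves (hclosed.frontier_subset hQ) harc hl hpair
    linarith [hD' Q]
end
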